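/- arXiv:1510.04800 — 5 statements merged into one kernel-verified Lean document; each statement's English description precedes it below -/
import Mathlib

section
/- Let g be a negative integer, let s_1 = v_2(g) and s_2 = v_7(g), and let l(X) = X^4 - X^3 + X + 1 ∈ ℤ[X]. Let D be the set of primes p such that (p = 3, or p divides g and p ∉ {2,7}), the Legendre symbol (-14/p) = 1, and l(X) is irreducible as a polynomial over ℤ/pℤ. Then the diophantine equation 3x^2 + 2xy + 5y^2 + g = 0 has a solution in integers x, y if and only if all of the following hold: (1) the odd integer 3g·2^{-s_1} is congruent to 1 or -1 modulo 8; (2) the Legendre symbol (g·7^{-s_2}/7) = 1; (3) for every prime p ∉ {2,3,7} such that v_p(g) is odd, the Legendre symbol (-14/p) = 1; (4) the sum Σ_{p ∈ D} v_p(3g) is even. -/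
open Polynomial in
theorem irreducible_quartic {F : Type*} [Field F] (h2 : ¬ IsSquare (2 : F))
    (h7 : ¬ IsSquare (-7 : F)) : Irreducible (X ^ 4 - X ^ 3 + X + 1 : F[X]) := by
  have hdeg : (X ^ 4 - X ^ 3 + X + 1 : F[X]).natDegree = 4 := by compute_degree!
  have hmonic : (X ^ 4 - X ^ 3 + X + 1 : F[X]).Monic := by monicity!
  rw [hmonic.irreducible_iff_natDegree']
  refine ⟨fun h => by simp [h] at hdeg, fun f g hf hg hfg hmem => ?_⟩
  rw [hdeg, Finset.mem_Ioc] at hmem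
  have hsum : f.natDegree + g.natDegree = 4 := by rw [← hf.natDegree_mul hg, hfg, hdeg]
  obtain h | h : g.natDegree = 1 ∨ g.natDegree = 2 := by omega
  · obtain ⟨t, ht⟩ := exists_root_of_degree_eq_one
      ((degree_eq_iff_natDegree_eq_of_pos one_pos).2 h)
    have hroot := congrArg (eval t) hfg
    rw [eval_mul, ht.eq_zero, mul_zero] at hroot
    simp only [eval_add, eval_sub, eval_pow, eval_X, eval_one] at hroot
    have ht0 : t ≠ 0 := by rintro rfl; simp at hroot
    refine h7 ⟨(2 * t ^ 2 - t - 2) / t, ?_⟩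
    field_simp
    linear_combination 4 * hroot
  · have quadratic : ∀ q : F[X], q.Monic → q.natDegree = 2 →
        q = X ^ 2 + C (q.coeff 1) * X + C (q.coeff 0) := fun q hq hq2 => by
      conv_lhs => rw [hq.as_sum, hq2]
      simp [Finset.sum_range_succ]
      ring
    rw [quadratic f hf (by omega), quadratic g hg h] at hfg
    generalize f.coeff 1 = a at hfg
    generalize f.coeff 0 = b at hfg
    generalize g.coeff 1 = c at hfg
    generalize g.coeff 0 = d at hfg
    have expand : (X ^ 2 + C a * X + C b) * (X ^ 2 + C c * X + C d) =
        X ^ 4 + C (a + c) * X ^ 3 + C (b + d + a * c) * X ^ 2 + C (a * d + b * c) * X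
          + C (b * d) := by
      simp only [C_add, C_mul]
      ring
    rw [expand] at hfg
    have e0 := congrArg (coeff · 0) hfg
    have e1 := congrArg (coeff · 1) hfg
    have e2 := congrArg (coeff · 2) hfg
    have e3 := congrArg (coeff · 3) hfg
    simp [coeff_X, coeff_one, coeff_X_pow, coeff_C, -map_add, -map_mul] at e0 e1 e2 e3
    have resolvent : (b + d + 2) * ((b + d - 1) ^ 2 - 2) = 0 := by
      have e4 : a * b + c * d = -(b + d) - 1 := by linear_combination (b + d) * e3 - e1
      have key : (a * d + b * c) * (a * b + c * d) =
          ((a + c) ^ 2 - 2 * (a * c)) * (b * d) + a * c * ((b + d) ^ 2 - 2 * (b * d)) := by ring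
      rw [e1, e4, e3, e0, show a * c = -(b + d) by linear_combination e2] at key
      linear_combination key
    rcases mul_eq_zero.1 resolvent with h | h
    · exact h7 ⟨a - c, by linear_combination 4 * e2 - 4 * h - (a + c - 1) * e3⟩
    · exact h2 ⟨b + d - 1, by linear_combination -h⟩

open Polynomial in
theorem not_isSquare_of_irreducible_quartic {F : Type*} [Field F] (htwo : (2 : F) ≠ 0)
    (h : Irreducible (X ^ 4 - X ^ 3 + X + 1 : F[X])) : ¬ IsSquare (-7 : F) := by
  rintro ⟨s, hs⟩
  have hdeg : (X ^ 4 - X ^ 3 + X + 1 : F[X]).natDegree = 4 := by compute_degree!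
  have hmonic : (X ^ 4 - X ^ 3 + X + 1 : F[X]).Monic := by monicity!
  rw [hmonic.irreducible_iff_natDegree'] at h
  have aux : ∀ r : F, (X ^ 2 + C r * X - 1 : F[X]).natDegree = 2 := fun r => by compute_degree!
  have aux' : ∀ r : F, (X ^ 2 + C r * X - 1 : F[X]).Monic := fun r => by monicity!
  refine h.2 (X ^ 2 + C ((s - 1) / 2) * X - 1) (X ^ 2 + C ((-s - 1) / 2) * X - 1)
    (aux' _) (aux' _) ?_ (by rw [aux, hdeg]; simp)
  have e1 : C ((s - 1) / 2) + C ((-s - 1) / 2) = (-1 : F[X]) := by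
    rw [← C_add, ← C_1, ← C_neg]; congr 1; field_simp; ring
  have e2 : C ((s - 1) / 2) * C ((-s - 1) / 2) = (2 : F[X]) := by
    rw [← C_mul, show (2 : F[X]) = C 2 from rfl]; congr 1; field_simp
    linear_combination hs
  linear_combination (X ^ 3 - X) * e1 + X ^ 2 * e2

theorem descent_sq_add_fourteen_sq {p : ℤ} (hp : 1 < p) {R : ℕ → ℤ → Prop}
    (step : ∀ s u, R s u → R (s + 2) u)
    (base : ∀ a b : ℤ, ¬ (p ∣ a ∧ p ∣ b) → ∃ s u, a ^ 2 + 14 * b ^ 2 = p ^ s * u ∧ R s u)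
    (a b : ℤ) (hab : a ^ 2 + 14 * b ^ 2 ≠ 0) :
    ∃ s u, a ^ 2 + 14 * b ^ 2 = p ^ s * u ∧ R s u := by
  induction h : (a ^ 2 + 14 * b ^ 2).natAbs using Nat.strong_induction_on generalizing a b with
  | _ n ih =>
    by_cases hdvd : p ∣ a ∧ p ∣ b
    · obtain ⟨⟨a, rfl⟩, b, rfl⟩ := hdvd
      have hfac : (p * a) ^ 2 + 14 * (p * b) ^ 2 = p ^ 2 * (a ^ 2 + 14 * b ^ 2) := by ring
      have hne : a ^ 2 + 14 * b ^ 2 ≠ 0 := fun h0 => hab (by rw [hfac, h0, mul_zero])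
      have hpos : 0 < a ^ 2 + 14 * b ^ 2 := lt_of_le_of_ne (by positivity) hne.symm
      obtain ⟨s, u, hsu, hR⟩ := ih _ (by
        rw [← h, hfac]
        apply Int.natAbs_lt_natAbs_of_nonneg_of_lt hpos.le
        exact lt_mul_of_one_lt_left hpos (one_lt_pow₀ hp two_ne_zero)) a b hne rfl
      exact ⟨s + 2, u, by rw [hfac, hsu]; ring, step s u hR⟩
    · exact base a b hdvd

theorem two_adic_sq_add_fourteen_sq (a b : ℤ) (hab : a ^ 2 + 14 * b ^ 2 ≠ 0) :
    ∃ (s : ℕ) (u : ℤ), a ^ 2 + 14 * b ^ 2 = 2 ^ s * u ∧ (u % 8 = 1 ∨ u % 8 = 7) := by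
  refine descent_sq_add_fourteen_sq (R := fun _ u => u % 8 = 1 ∨ u % 8 = 7) one_lt_two
    (fun _ _ h => h) (fun a b h => ?_) a b hab
  have sq_mod : ∀ t : ℤ, t % 2 = 1 → t ^ 2 % 8 = 1 := fun t ht => by
    have : t % 8 = 1 ∨ t % 8 = 3 ∨ t % 8 = 5 ∨ t % 8 = 7 := by omega
    rcases this with h | h | h | h <;> simp [pow_two, Int.mul_emod, h]
  rcases Int.emod_two_eq_zero_or_one a with ha | ha
  · obtain ⟨c, rfl⟩ := Int.dvd_of_emod_eq_zero ha
    have hb := sq_mod b (by omega)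
    refine ⟨1, 2 * c ^ 2 + 7 * b ^ 2, by ring, ?_⟩
    rcases Int.emod_two_eq_zero_or_one c with hc | hc
    · obtain ⟨d, rfl⟩ := Int.dvd_of_emod_eq_zero hc
      ring_nf at hb ⊢
      omega
    · have := sq_mod c hc
      omega
  · have ha' := sq_mod a ha
    refine ⟨0, a ^ 2 + 14 * b ^ 2, by ring, ?_⟩
    rcases Int.emod_two_eq_zero_or_one b with hb | hb
    · obtain ⟨d, rfl⟩ := Int.dvd_of_emod_eq_zero hb
      ring_nf at ha' ⊢
      omega
    · have := sq_mod b hb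
      omega

theorem seven_adic_sq_add_fourteen_sq (a b : ℤ) (hab : a ^ 2 + 14 * b ^ 2 ≠ 0) :
    ∃ (s : ℕ) (u : ℤ), a ^ 2 + 14 * b ^ 2 = 7 ^ s * u ∧
      (u % 7 = 1 ∨ u % 7 = 2 ∨ u % 7 = 4) := by
  refine descent_sq_add_fourteen_sq (R := fun _ u => u % 7 = 1 ∨ u % 7 = 2 ∨ u % 7 = 4)
    (by norm_num) (fun _ _ h => h) (fun a b h => ?_) a b hab
  have sq_mod : ∀ t : ℤ, t % 7 ≠ 0 → t ^ 2 % 7 = 1 ∨ t ^ 2 % 7 = 2 ∨ t ^ 2 % 7 = 4 :=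
    fun t ht => by
      have : t % 7 = 1 ∨ t % 7 = 2 ∨ t % 7 = 3 ∨ t % 7 = 4 ∨ t % 7 = 5 ∨ t % 7 = 6 := by omega
      rcases this with h | h | h | h | h | h <;> simp [pow_two, Int.mul_emod, h]
  by_cases ha : a % 7 = 0
  · obtain ⟨c, rfl⟩ := Int.dvd_of_emod_eq_zero ha
    have hb := sq_mod b (by omega)
    exact ⟨1, 7 * c ^ 2 + 2 * b ^ 2, by ring, by omega⟩
  · have := sq_mod a ha
    exact ⟨0, a ^ 2 + 14 * b ^ 2, by ring, by omega⟩

theorem inert_sq_add_fourteen_sq {p : ℕ} [hp : Fact p.Prime] (h : legendreSym p (-14) = -1)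
    (a b : ℤ) (hab : a ^ 2 + 14 * b ^ 2 ≠ 0) :
    ∃ (s : ℕ) (u : ℤ), a ^ 2 + 14 * b ^ 2 = (p : ℤ) ^ s * u ∧ (Even s ∧ ¬ (p : ℤ) ∣ u) := by
  refine descent_sq_add_fourteen_sq (R := fun s u => Even s ∧ ¬ (p : ℤ) ∣ u)
    (by exact_mod_cast hp.out.one_lt) (fun s u h => ⟨h.1.add even_two, h.2⟩)
    (fun a b hdvd => ?_) a b hab
  refine ⟨0, a ^ 2 + 14 * b ^ 2, by ring, Even.zero, fun hd => hdvd ?_⟩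
  exact legendreSym.prime_dvd_of_eq_neg_one h (x := a) (y := b) (by convert hd using 1; ring)

theorem pow_mul_unique {p : ℤ} (hp : p ≠ 0) {s t : ℕ} {u v : ℤ} (hu : ¬ p ∣ u) (hv : ¬ p ∣ v)
    (h : p ^ s * u = p ^ t * v) : s = t ∧ u = v := by
  wlog hst : s ≤ t generalizing s t u v
  · have := this hv hu h.symm (by omega)
    exact ⟨this.1.symm, this.2.symm⟩
  obtain ⟨k, rfl⟩ := Nat.exists_eq_add_of_le hst
  rw [pow_add, mul_assoc] at h
  have h' := mul_left_cancel₀ (pow_ne_zero s hp) h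
  rcases k with _ | k
  · simpa using h'
  · exact absurd ⟨p ^ k * v, by rw [h']; ring⟩ hu

theorem exists_eq_pow_padicValInt_mul {p : ℕ} [Fact p.Prime] {z : ℤ} (hz : z ≠ 0) :
    z = (p : ℤ) ^ padicValInt p z * (z / (p : ℤ) ^ padicValInt p z) ∧
      ¬ (p : ℤ) ∣ z / (p : ℤ) ^ padicValInt p z := by
  have h1 : (p : ℤ) ^ padicValInt p z ∣ z := (padicValInt_dvd_iff _ _).2 (Or.inr le_rfl)
  have h2 := (Int.mul_ediv_cancel' h1).symm
  refine ⟨h2, fun ⟨k, hk⟩ => ?_⟩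
  have h3 : (p : ℤ) ^ (padicValInt p z + 1) ∣ z := ⟨k, by
    conv_lhs => rw [h2, hk]
    ring⟩
  rcases (padicValInt_dvd_iff _ _).1 h3 with h | h
  · exact hz h
  · omega

theorem form_reduction (n : ℕ) : ∀ a b c : ℤ, 0 < a → a.toNat = n → a * c = b ^ 2 + 14 →
    ∀ X Y : ℤ, ∃ x y : ℤ,
      a * X ^ 2 + 2 * b * X * Y + c * Y ^ 2 = x ^ 2 + 14 * y ^ 2 ∨
      a * X ^ 2 + 2 * b * X * Y + c * Y ^ 2 = 2 * x ^ 2 + 7 * y ^ 2 ∨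
      a * X ^ 2 + 2 * b * X * Y + c * Y ^ 2 = 3 * x ^ 2 + 2 * x * y + 5 * y ^ 2 := by
  induction n using Nat.strong_induction_on with
  | _ n ih =>
    intro a b₀ c₀ ha hn h₀ X₀ Y
    obtain ⟨k, hk1, hk2⟩ : ∃ k : ℤ, -a ≤ 2 * (b₀ - k * a) ∧ 2 * (b₀ - k * a) ≤ a := by
      have h1 := Int.emod_add_mul_ediv (2 * b₀ + a) (2 * a)
      have h2 := Int.emod_nonneg (2 * b₀ + a) (show 2 * a ≠ 0 by omega)
      have h3 := Int.emod_lt_of_pos (2 * b₀ + a) (show 0 < 2 * a by omega)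
      exact ⟨(2 * b₀ + a) / (2 * a), by linarith, by linarith⟩
    obtain ⟨b, hb⟩ : ∃ b, b = b₀ - k * a := ⟨_, rfl⟩
    obtain ⟨c, hc⟩ : ∃ c, c = c₀ - 2 * k * b₀ + k ^ 2 * a := ⟨_, rfl⟩
    obtain ⟨X, hX⟩ : ∃ X, X = X₀ + k * Y := ⟨_, rfl⟩
    rw [← hb] at hk1 hk2
    have h : a * c = b ^ 2 + 14 := by rw [hb, hc]; linear_combination h₀
    have hval : a * X₀ ^ 2 + 2 * b₀ * X₀ * Y + c₀ * Y ^ 2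
        = a * X ^ 2 + 2 * b * X * Y + c * Y ^ 2 := by rw [hX, hb, hc]; ring
    rw [hval]
    have hcpos : 0 < c := by
      by_contra hc0
      nlinarith
    by_cases hca : c < a
    · obtain ⟨x, y, hxy⟩ := ih c.toNat (by omega) c b a hcpos rfl (by linarith) Y X
      rw [show a * X ^ 2 + 2 * b * X * Y + c * Y ^ 2
        = c * Y ^ 2 + 2 * b * Y * X + a * X ^ 2 by ring]
      exact ⟨x, y, hxy⟩
    · have ha4 : a ≤ 4 := by nlinarith
      have hb1 : -2 ≤ b := by omega
      have hb2 : b ≤ 2 := by omega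
      interval_cases a <;> interval_cases b <;> try omega
      · exact ⟨X, Y, Or.inl (by rw [show c = 14 by omega]; ring)⟩
      · exact ⟨X, Y, Or.inr (Or.inl (by rw [show c = 7 by omega]; ring))⟩
      · exact ⟨X, -Y, Or.inr (Or.inr (by rw [show c = 5 by omega]; ring))⟩
      · exact ⟨X, Y, Or.inr (Or.inr (by rw [show c = 5 by omega]; ring))⟩

theorem exists_dvd_sq_sub_of_squarefree (a : ℤ) (m : ℕ) (hm : Squarefree m)
    (h : ∀ p : ℕ, p.Prime → p ∣ m → ∃ B : ℤ, (p : ℤ) ∣ B ^ 2 - a) :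
    ∃ B : ℤ, (m : ℤ) ∣ B ^ 2 - a := by
  induction m using induction_on_primes with
  | zero => exact absurd hm not_squarefree_zero
  | one => exact ⟨0, by simp⟩
  | prime_mul p m hp ih =>
    obtain ⟨hcop, -, hsq⟩ := Nat.squarefree_mul_iff.1 hm
    obtain ⟨B, hB⟩ := h p hp (dvd_mul_right p m)
    obtain ⟨C, hC⟩ := ih hsq fun q hq hqm => h q hq (hqm.mul_left p)
    have hcop' : IsCoprime (p : ℤ) m := Nat.isCoprime_iff_coprime.2 hcop
    have ⟨u, v, huv⟩ := hcop'
    refine ⟨B * (v * m) + C * (u * p), ?_⟩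
    rw [Nat.cast_mul]
    refine IsCoprime.mul_dvd hcop' ?_ ?_
    · obtain ⟨r, hr⟩ := hB
      exact ⟨r + (C - B) * u * (2 * B + (C - B) * u * p), by
        rw [show v * m = 1 - u * p by linear_combination huv]
        linear_combination hr⟩
    · obtain ⟨r, hr⟩ := hC
      exact ⟨r + (B - C) * v * (2 * C + (B - C) * v * m), by
        rw [show u * p = 1 - v * m by linear_combination huv]
        linear_combination hr⟩

theorem exists_form_of_local_conditions {g : ℤ} (hg : g < 0)
    (htwo : ∀ (s : ℕ) (u : ℤ), -g = 2 ^ s * u → ¬ (u % 8 = 1 ∨ u % 8 = 7))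
    (hodd : ∀ p : ℕ, ∀ hp : p.Prime, p ≠ 2 → p ≠ 3 → p ≠ 7 →
      Odd (padicValInt p g) → @legendreSym p ⟨hp⟩ (-14) = 1) :
    ∃ x y : ℤ, 3 * x ^ 2 + 2 * x * y + 5 * y ^ 2 + g = 0 := by
  obtain ⟨m, d, hmd, hm⟩ := Nat.sq_mul_squarefree g.natAbs
  have hgnat : g.natAbs ≠ 0 := by omega
  have hm0 : m ≠ 0 := hm.ne_zero
  have hd0 : d ≠ 0 := by rintro rfl; simp at hmd; omega
  have hgd : -g = (d : ℤ) ^ 2 * m := by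
    rw [← Int.ofNat_natAbs_of_nonpos hg.le, ← hmd]
    push_cast
    ring
  have hlocal : ∀ p : ℕ, p.Prime → p ∣ m → ∃ B : ℤ, (p : ℤ) ∣ B ^ 2 - (-14) := by
    intro p hp hpm
    by_cases h2 : p = 2
    · exact ⟨0, by subst h2; norm_num⟩
    by_cases h3 : p = 3
    · exact ⟨1, by subst h3; norm_num⟩
    by_cases h7 : p = 7
    · exact ⟨0, by subst h7; norm_num⟩
    have : Fact p.Prime := ⟨hp⟩
    have hval : padicValInt p g = 2 * d.factorization p + 1 := by
      rw [padicValInt, ← Nat.factorization_def _ hp, ← hmd,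
        Nat.factorization_mul (pow_ne_zero 2 hd0) hm0, Nat.factorization_pow]
      have h1 := hp.factorization_pos_of_dvd hm0 hpm
      have h2 := hm.natFactorization_le_one p
      simp
      omega
    have hleg := hodd p hp h2 h3 h7 (by rw [hval]; exact ⟨d.factorization p, by ring⟩)
    have hne : ((-14 : ℤ) : ZMod p) ≠ 0 := fun h0 => by
      rw [(legendreSym.eq_zero_iff p (-14)).2 h0] at hleg
      exact zero_ne_one hleg
    obtain ⟨r, hr⟩ := (legendreSym.eq_one_iff p hne).1 hleg
    obtain ⟨B, rfl⟩ := ZMod.intCast_surjective r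
    refine ⟨B, (ZMod.intCast_zmod_eq_zero_iff_dvd _ _).1 ?_⟩
    rw [Int.cast_sub, hr]
    push_cast
    ring
  obtain ⟨B, c, hc⟩ := exists_dvd_sq_sub_of_squarefree (-14) m hm hlocal
  obtain ⟨x, y, hxy⟩ := form_reduction m m B c (by exact_mod_cast Nat.pos_of_ne_zero hm0)
    (by simp) (by linear_combination -hc) 1 0
  have hm_eq : (m : ℤ) = m * 1 ^ 2 + 2 * B * 1 * 0 + c * 0 ^ 2 := by ring
  rw [← hm_eq] at hxy
  rcases hxy with h | h | h
  · have hg' : -g = (d * x) ^ 2 + 14 * (d * y) ^ 2 := by rw [hgd, h]; ring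
    obtain ⟨s, u, hsu, hu⟩ := two_adic_sq_add_fourteen_sq (d * x) (d * y) (by omega)
    exact absurd hu (htwo s u (hg'.trans hsu))
  · have hg' : 2 * -g = (2 * (d * x)) ^ 2 + 14 * (d * y) ^ 2 := by rw [hgd, h]; ring
    obtain ⟨s, u, hsu, hu⟩ := two_adic_sq_add_fourteen_sq (2 * (d * x)) (d * y) (by omega)
    rw [← hg'] at hsu
    rcases s with _ | s
    · rw [pow_zero, one_mul] at hsu
      omega
    · exact absurd hu (htwo s u (by rw [pow_succ] at hsu; linarith))
  · exact ⟨d * x, d * y, by linear_combination (d : ℤ) ^ 2 * (-h) - hgd⟩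

theorem legendreSym_neg_fourteen {p : ℕ} [Fact p.Prime] :
    legendreSym p (-14) = legendreSym p 2 * legendreSym p (-7) := by
  rw [← legendreSym.mul]
  norm_num

theorem legendreSym_two_of_irreducible_quartic {p : ℕ} [hp : Fact p.Prime] (hp2 : p ≠ 2)
    (h14 : legendreSym p (-14) = 1) :
    legendreSym p 2 = -1 ↔ Irreducible ((Polynomial.X ^ 4 - Polynomial.X ^ 3 + Polynomial.X + 1 :
      Polynomial ℤ).map (Int.castRingHom (ZMod p))) := by
  have hmul := legendreSym_neg_fourteen (p := p)
  rw [h14] at hmul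
  have hmap : (Polynomial.X ^ 4 - Polynomial.X ^ 3 + Polynomial.X + 1 :
      Polynomial ℤ).map (Int.castRingHom (ZMod p))
      = Polynomial.X ^ 4 - Polynomial.X ^ 3 + Polynomial.X + 1 := by simp
  rw [hmap]
  constructor
  · intro h
    rw [h] at hmul
    have h7 : legendreSym p (-7) = -1 := by linarith
    refine irreducible_quartic ?_ ?_
    · simpa using (legendreSym.eq_neg_one_iff p).1 h
    · simpa using (legendreSym.eq_neg_one_iff p).1 h7
  · intro h
    have htwo : (2 : ZMod p) ≠ 0 := by
      have := Ring.two_ne_zero (R := ZMod p) (by rwa [ZMod.ringChar_zmod_n])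
      exact this
    have h7 : legendreSym p (-7) = -1 := by
      rw [legendreSym.eq_neg_one_iff]
      simpa using not_isSquare_of_irreducible_quartic htwo h
    rw [h7] at hmul
    linarith

theorem even_finsum_of_chi_eight {N : ℕ} (hN : N ≠ 0) (D : Set ℕ)
    (hDN : ∀ p ∈ D, p.Prime ∧ p ≠ 2 ∧ p ∣ N) (hD : ∀ p ∈ D, ZMod.χ₈ p = -1)
    (hD' : ∀ p, p.Prime → p ≠ 2 → p ∉ D → Odd (N.factorization p) → ZMod.χ₈ p = 1)
    (hodd : ZMod.χ₈ (ordCompl[2] N : ℕ) = 1) :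
    Even (∑ᶠ p ∈ D, N.factorization p) := by
  classical
  set u := ordCompl[2] N with hu
  have hu0 : u ≠ 0 := (Nat.ordCompl_pos 2 hN).ne'
  have hfac : ∀ p, p ≠ 2 → u.factorization p = N.factorization p := fun p hp => by
    rw [hu, Nat.factorization_ordCompl, Finsupp.erase_ne hp]
  have hu2 : ¬ 2 ∣ u := Nat.not_dvd_ordCompl Nat.prime_two hN
  have hDu : D = (u.primeFactors.filter (· ∈ D) : Finset ℕ) := by
    ext p
    simp only [Finset.coe_filter, Set.mem_ofPred_eq]
    refine ⟨fun hp => ⟨?_, hp⟩, fun hp => hp.2⟩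
    obtain ⟨hprime, hp2, hpN⟩ := hDN p hp
    rw [← Nat.support_factorization, Finsupp.mem_support_iff, hfac p hp2]
    exact (hprime.factorization_pos_of_dvd hN hpN).ne'
  have hprod : ZMod.χ₈ (u : ℕ) = ∏ p ∈ u.primeFactors, ZMod.χ₈ (p : ℕ) ^ u.factorization p := by
    conv_lhs => rw [← Nat.prod_factorization_pow_eq_self hu0]
    rw [Finsupp.prod, Nat.support_factorization]
    push_cast
    simp_rw [map_prod, map_pow]
  have hterm : ∀ p ∈ u.primeFactors, ZMod.χ₈ (p : ℕ) ^ u.factorization p =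
      if p ∈ D then (-1) ^ N.factorization p else 1 := by
    intro p hp
    have hpp := Nat.prime_of_mem_primeFactors hp
    have hp2 : p ≠ 2 := by
      rintro rfl
      exact hu2 (Nat.dvd_of_mem_primeFactors hp)
    have hp8 : ZMod.χ₈ (p : ℕ) = 1 ∨ ZMod.χ₈ (p : ℕ) = -1 := by
      have := hpp.eq_two_or_odd
      rw [ZMod.χ₈_nat_eq_if_mod_eight]
      split_ifs <;> omega
    rw [hfac p hp2]
    split_ifs with hpD
    · rw [hD p hpD]
    · rcases Nat.even_or_odd (N.factorization p) with he | ho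
      · rcases hp8 with h | h <;> simp [h, he]
      · rw [hD' p hpp hp2 hpD ho, one_pow]
  rw [hodd, Finset.prod_congr rfl hterm, ← Finset.prod_filter, Finset.prod_pow_eq_pow_sum] at hprod
  rw [hDu, finsum_mem_coe_finset]
  exact neg_one_pow_eq_one_iff_even (by norm_num) |>.1 hprod.symm

open Polynomial in
/-- Criterion for solvability of `3x² + 2xy + 5y² + g = 0` over `ℤ` for `g < 0`. -/
theorem solvable_3_2_5_iff (g : ℤ) (hg : g < 0)
    (s1 s2 : ℕ) (hs1 : s1 = padicValInt 2 g) (hs2 : s2 = padicValInt 7 g)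
    (l : Polynomial ℤ) (hl : l = X ^ 4 - X ^ 3 + X + 1)
    (D : Set ℕ)
    (hD : D = {p : ℕ | ∃ hp : p.Prime,
      (p = 3 ∨ ((p : ℤ) ∣ g ∧ p ≠ 2 ∧ p ≠ 7)) ∧
      @legendreSym p ⟨hp⟩ (-14) = 1 ∧
      Irreducible (l.map (Int.castRingHom (ZMod p)))}) :
    (∃ x y : ℤ, 3 * x ^ 2 + 2 * x * y + 5 * y ^ 2 + g = 0) ↔
      ((3 * g / 2 ^ s1) % 8 = 1 ∨ (3 * g / 2 ^ s1) % 8 = 7) ∧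
      @legendreSym 7 ⟨by norm_num⟩ (g / 7 ^ s2) = 1 ∧
      (∀ p : ℕ, ∀ hp : p.Prime, p ≠ 2 → p ≠ 3 → p ≠ 7 →
        Odd (padicValInt p g) → @legendreSym p ⟨hp⟩ (-14) = 1) ∧
      Even (∑ᶠ p ∈ D, padicValInt p (3 * g)) := by
  have hg0 : g ≠ 0 := hg.ne
  have : Fact (Nat.Prime 7) := ⟨by norm_num⟩
  have : Fact (Nat.Prime 3) := ⟨by norm_num⟩
  obtain ⟨hw2, hw2'⟩ := exists_eq_pow_padicValInt_mul (p := 2) hg0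
  obtain ⟨hw7, hw7'⟩ := exists_eq_pow_padicValInt_mul (p := 7) hg0
  rw [← hs1] at hw2 hw2'
  rw [← hs2] at hw7 hw7'
  push_cast at hw2 hw2' hw7 hw7'
  have hdiv : 3 * g / 2 ^ s1 = 3 * (g / 2 ^ s1) := Int.mul_ediv_assoc _ ⟨_, hw2⟩
  rw [hdiv]
  generalize g / 2 ^ s1 = w at *
  generalize g / 7 ^ s2 = v at *
  have hfact : ∀ p : ℕ, p.Prime → padicValInt p (3 * g) = (3 * g).natAbs.factorization p :=
    fun p hp => (Nat.factorization_def _ hp).symm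
  have hval3 : ∀ p : ℕ, p.Prime → p ≠ 3 → padicValInt p (3 * g) = padicValInt p g := by
    intro p hp hp3
    have : Fact p.Prime := ⟨hp⟩
    rw [padicValInt.mul (by norm_num) hg0, Nat.add_eq_right]
    refine padicValInt.eq_zero_of_not_dvd fun h => hp3 ?_
    exact (Nat.prime_dvd_prime_iff_eq hp Nat.prime_three).1 (by exact_mod_cast h)
  constructor
  · rintro ⟨x, y, hxy⟩
    have hrep : (3 * x + y) ^ 2 + 14 * y ^ 2 = -3 * g := by linear_combination 3 * hxy
    have hne : (3 * x + y) ^ 2 + 14 * y ^ 2 ≠ 0 := by omega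
    have h1 : 3 * w % 8 = 1 ∨ 3 * w % 8 = 7 := by
      obtain ⟨s, u, hsu, hu⟩ := two_adic_sq_add_fourteen_sq _ _ hne
      have := (pow_mul_unique (p := 2) two_ne_zero (u := u) (v := -3 * w) (by omega) (by omega)
        (by rw [← hsu, hrep]; linear_combination -3 * hw2)).2
      omega
    have h2 : legendreSym 7 v = 1 := by
      obtain ⟨s, u, hsu, hu⟩ := seven_adic_sq_add_fourteen_sq _ _ hne
      have := (pow_mul_unique (p := 7) (by norm_num) (u := u) (v := -3 * v) (by omega) (by omega)
        (by rw [← hsu, hrep]; linear_combination -3 * hw7)).2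
      rw [legendreSym.mod]
      have hv : v % 7 = 1 ∨ v % 7 = 2 ∨ v % 7 = 4 := by omega
      rcases hv with h | h | h <;> norm_num [h]
    have h3 : ∀ p : ℕ, ∀ hp : p.Prime, p ≠ 2 → p ≠ 3 → p ≠ 7 →
        Odd (padicValInt p g) → @legendreSym p ⟨hp⟩ (-14) = 1 := by
      intro p hp hp2 hp3 hp7 hodd
      have : Fact p.Prime := ⟨hp⟩
      have h14 : ((-14 : ℤ) : ZMod p) ≠ 0 := by
        rw [Ne, ZMod.intCast_zmod_eq_zero_iff_dvd, Int.dvd_neg]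
        intro h
        have h' : p ∣ 2 * 7 := by exact_mod_cast h
        rcases hp.dvd_mul.1 h' with h | h
        · exact hp2 ((Nat.prime_dvd_prime_iff_eq hp Nat.prime_two).1 h)
        · exact hp7 ((Nat.prime_dvd_prime_iff_eq hp (by norm_num)).1 h)
      refine (legendreSym.eq_one_or_neg_one p h14).resolve_right fun hneg => ?_
      obtain ⟨s, u, hsu, hs, hu⟩ := inert_sq_add_fourteen_sq hneg _ _ hne
      obtain ⟨hwp, hwp'⟩ := exists_eq_pow_padicValInt_mul (p := p) hg0
      have hp3' : ¬ (p : ℤ) ∣ -3 := by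
        rw [Int.dvd_neg]
        intro h
        exact hp3 ((Nat.prime_dvd_prime_iff_eq hp Nat.prime_three).1 (by exact_mod_cast h))
      have heq := (pow_mul_unique (by exact_mod_cast hp.ne_zero) hu
        (fun h => ((Nat.prime_iff_prime_int.1 hp).dvd_or_dvd h).elim hp3' hwp')
        (hsu.symm.trans (hrep.trans (by rw [mul_left_comm, ← hwp])))).1
      rw [← heq] at hodd
      exact Nat.not_even_iff_odd.2 hodd hs
    refine ⟨h1, h2, h3, ?_⟩
    have hprime : ∀ p ∈ D, p.Prime := fun p hp => by rw [hD] at hp; exact hp.1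
    rw [finsum_mem_congr rfl fun p hp => hfact p (hprime p hp)]
    have hD2 : ∀ p ∈ D, p ≠ 2 := by
      rw [hD]
      rintro p ⟨-, rfl | h, -⟩
      · norm_num
      · exact h.2.1
    refine even_finsum_of_chi_eight (by omega) D (fun p hp => ⟨hprime p hp, hD2 p hp, ?_⟩)
      (fun p hp => ?_) (fun p hpp hp2 hpD hpo => ?_) ?_
    · rw [hD] at hp
      obtain ⟨-, rfl | h, -⟩ := hp
      · rw [Int.natAbs_mul]; exact dvd_mul_right 3 _
      · exact Int.natCast_dvd.1 (h.1.mul_left 3)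
    · have hp2 := hD2 p hp
      rw [hD, hl] at hp
      obtain ⟨hpp, -, h14, hirr⟩ := hp
      have : Fact p.Prime := ⟨hpp⟩
      rw [← legendreSym.at_two hp2]
      exact (legendreSym_two_of_irreducible_quartic hp2 h14).2 hirr
    · have : Fact p.Prime := ⟨hpp⟩
      by_cases hp7 : p = 7
      · subst hp7; decide
      have h14 : legendreSym p (-14) = 1 := by
        by_cases hp3 : p = 3
        · subst hp3; norm_num
        · rw [← hfact p hpp, hval3 p hpp hp3] at hpo
          exact h3 p hpp hp2 hp3 hp7 hpo
      have htwo0 : ((2 : ℤ) : ZMod p) ≠ 0 := by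
        have := Ring.two_ne_zero (R := ZMod p) (by rwa [ZMod.ringChar_zmod_n])
        exact_mod_cast this
      rw [← legendreSym.at_two hp2]
      refine (legendreSym.eq_one_or_neg_one p htwo0).resolve_right fun hneg => hpD ?_
      rw [hD, hl]
      refine ⟨hpp, ?_, h14, (legendreSym_two_of_irreducible_quartic hp2 h14).1 hneg⟩
      by_cases hp3 : p = 3
      · exact Or.inl hp3
      · refine Or.inr ⟨?_, hp2, hp7⟩
        rw [← hfact p hpp, hval3 p hpp hp3] at hpo
        by_contra hdvd
        rw [padicValInt.eq_zero_of_not_dvd hdvd] at hpo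
        exact absurd hpo (by decide)
    · have hordCompl : ordCompl[2] (3 * g).natAbs = (3 * w).natAbs := by
        have hw3 : ¬ 2 ∣ (3 * w).natAbs := by omega
        rw [show 3 * g = 2 ^ s1 * (3 * w) by linear_combination 3 * hw2, Int.natAbs_mul,
          Int.natAbs_pow]
        exact Nat.ordCompl_pow_mul_of_not_dvd s1 Nat.prime_two hw3
      rw [hordCompl, ZMod.χ₈_nat_eq_if_mod_eight]
      split_ifs <;> omega
  · rintro ⟨h1, -, h3, -⟩
    refine exists_form_of_local_conditions hg (fun s u hsu hu => ?_) h3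
    have := (pow_mul_unique (p := 2) two_ne_zero (u := u) (v := -w) (by omega) (by omega)
      (by rw [← hsu]; linear_combination -hw2)).2
    omega
end

section
/- Let g be a negative integer, let s_1 = v_2(g) and s_2 = v_7(g). Then the equation 3x^2 + 2xy + 5y^2 + g = 0 has a solution with x, y in the ring ℤ_p of p-adic integers for every prime p if and only if all of the following hold: (1) the odd integer 3g·2^{-s_1} is congruent to 1 or -1 modulo 8; (2) the Legendre symbol (g·7^{-s_2}/7) = 1; (3) for every prime p ∉ {2,3,7} such that v_p(g) is odd, the Legendre symbol (-14/p) = 1. -/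
lemma ZMod.natCast_ne_zero_of_prime_ne {p q : ℕ} [Fact p.Prime] (hq : q.Prime) (h : p ≠ q) : (q : ZMod p) ≠ 0 := by
  rw [Ne, ZMod.natCast_eq_zero_iff, Nat.prime_dvd_prime_iff_eq Fact.out hq]
  exact h

namespace PadicInt

variable {p : ℕ} [Fact p.Prime]

lemma toZMod_eq_zero_iff_dvd {x : ℤ_[p]} : toZMod x = 0 ↔ (p : ℤ_[p]) ∣ x := by
  rw [← RingHom.mem_ker, ker_toZMod, maximalIdeal_eq_span_p, Ideal.mem_span_singleton]

lemma isUnit_of_toZMod_ne_zero {x : ℤ_[p]} (h : toZMod x ≠ 0) : IsUnit x := by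
  by_contra hx
  exact h (toZMod_eq_zero_iff_dvd.2 ((norm_lt_one_iff_dvd x).1 (not_isUnit_iff.1 hx)))

lemma exists_sq_eq_of_norm_sq_sub_lt {u a : ℤ_[p]} (h : ‖a ^ 2 - u‖ < ‖2 * a‖ ^ 2) :
    ∃ z, z ^ 2 = u := by
  obtain ⟨z, hz, -⟩ := hensels_lemma (p := p) (R := ℤ_[p])
    (F := Polynomial.X ^ 2 - Polynomial.C u) (a := a) (by simpa [one_add_one_eq_two] using h)
  exact ⟨z, by simpa [sub_eq_zero] using hz⟩

lemma exists_sq_eq_of_toZMod (hp : p ≠ 2) {u : ℤ_[p]} (h0 : toZMod u ≠ 0)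
    (h : IsSquare (toZMod u)) : ∃ z, z ^ 2 = u := by
  obtain ⟨r, hr⟩ := h
  obtain ⟨a, rfl⟩ := ZMod.ringHom_surjective (toZMod (p := p)) r
  have ha : toZMod a ≠ 0 := by rintro h; simp [h] at hr; exact h0 (by simpa using hr)
  have h2 : (2 : ZMod p) ≠ 0 := mod_cast ZMod.natCast_ne_zero_of_prime_ne Nat.prime_two hp
  apply exists_sq_eq_of_norm_sq_sub_lt (a := a)
  rw [isUnit_iff.1 (isUnit_of_toZMod_ne_zero (x := 2 * a) (by simp [map_ofNat, ha, h2])), one_pow,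
    norm_lt_one_iff_dvd, ← toZMod_eq_zero_iff_dvd]
  simp [hr, sq]

lemma exists_sq_eq_of_toZModPow_three {u : ℤ_[2]} (h : toZModPow 3 u = 1) :
    ∃ z, z ^ 2 = u := by
  apply exists_sq_eq_of_norm_sq_sub_lt (a := 1)
  have h1 : toZModPow 3 (1 ^ 2 - u) = 0 := by simp [h]
  rw [← RingHom.mem_ker, ker_toZModPow, ← norm_le_pow_iff_mem_span_pow] at h1
  refine h1.trans_lt ?_
  have : ‖(2 : ℤ_[2])‖ = 2⁻¹ := by simpa using norm_p (p := 2)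
  rw [mul_one, this]
  norm_num

lemma exists_form_iff_exists_sq_add (hp : p ≠ 3) (g : ℤ_[p]) :
    (∃ x y : ℤ_[p], 3 * x ^ 2 + 2 * x * y + 5 * y ^ 2 + g = 0) ↔
      ∃ x y : ℤ_[p], x ^ 2 + 14 * y ^ 2 = -3 * g := by
  have h3 : toZMod (3 : ℤ_[p]) ≠ 0 := by
    rw [map_ofNat]
    exact mod_cast ZMod.natCast_ne_zero_of_prime_ne Nat.prime_three hp
  obtain ⟨t, ht⟩ := (isUnit_of_toZMod_ne_zero h3).exists_right_inv
  constructor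
  · rintro ⟨x, y, h⟩
    exact ⟨3 * x + y, y, by linear_combination 3 * h⟩
  · rintro ⟨x, y, h⟩
    refine ⟨t * (x - y), y, ?_⟩
    have h3' : (3 : ℤ_[p]) ≠ 0 := by rintro h; simp [h] at h3
    apply mul_left_cancel₀ h3'
    linear_combination h + ((3 * t + 1) * (x - y) ^ 2 + 2 * (x - y) * y) * ht

lemma exists_sq_add_iff_mod_two
    (hdiv : ∀ x y : ℤ_[p], (p : ℤ_[p]) ^ 2 ∣ x ^ 2 + 14 * y ^ 2 → (p : ℤ_[p]) ∣ x ∧ (p : ℤ_[p]) ∣ y)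
    (s : ℕ) (u : ℤ_[p]) :
    (∃ x y : ℤ_[p], x ^ 2 + 14 * y ^ 2 = p ^ s * u) ↔
      ∃ x y : ℤ_[p], x ^ 2 + 14 * y ^ 2 = p ^ (s % 2) * u := by
  induction s using Nat.twoStepInduction with
  | zero => simp
  | one => simp
  | more n ih _ =>
    rw [Nat.add_mod_right, ← ih]
    constructor
    · rintro ⟨x, y, h⟩
      obtain ⟨⟨x, rfl⟩, ⟨y, rfl⟩⟩ := hdiv x y (h ▸ ⟨p ^ n * u, by ring⟩)
      refine ⟨x, y, mul_left_cancel₀ (pow_ne_zero 2 (prime_p (p := p)).ne_zero) ?_⟩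
      linear_combination h
    · rintro ⟨x, y, h⟩
      exact ⟨p * x, p * y, by linear_combination (p : ℤ_[p]) ^ 2 * h⟩

lemma dvd_of_sq_dvd_sq_add {c : ℤ_[p]} (hc : ¬ (p : ℤ_[p]) ∣ c) (h14 : (14 : ℤ_[p]) = p * c)
    (x y : ℤ_[p]) (h : (p : ℤ_[p]) ^ 2 ∣ x ^ 2 + 14 * y ^ 2) :
    (p : ℤ_[p]) ∣ x ∧ (p : ℤ_[p]) ∣ y := by
  have hP := prime_p (p := p)
  obtain ⟨k, hk⟩ := h
  have hx : (p : ℤ_[p]) ∣ x := hP.dvd_of_dvd_pow (n := 2)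
    ⟨p * k - c * y ^ 2, by linear_combination hk - y ^ 2 * h14⟩
  obtain ⟨a, rfl⟩ := hx
  refine ⟨dvd_mul_right _ _, hP.dvd_of_dvd_pow (n := 2) ((hP.dvd_or_dvd (b := y ^ 2) (a := c)
    ⟨k - a ^ 2, mul_left_cancel₀ hP.ne_zero ?_⟩).resolve_left hc)⟩
  linear_combination hk - y ^ 2 * h14

lemma two_exists_sq_add_iff (s : ℕ) {u : ℤ_[2]} (hu : ¬ (2 : ℤ_[2]) ∣ u) :
    (∃ x y : ℤ_[2], x ^ 2 + 14 * y ^ 2 = 2 ^ s * u) ↔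
      toZModPow 3 u = 1 ∨ toZModPow 3 u = 7 := by
  have hP : Prime (2 : ℤ_[2]) := by simpa using prime_p (p := 2)
  have h7 : toZMod (7 : ℤ_[2]) ≠ 0 := by rw [map_ofNat]; decide
  have h := exists_sq_add_iff_mod_two (p := 2) (dvd_of_sq_dvd_sq_add (c := 7)
    (by rwa [← toZMod_eq_zero_iff_dvd]) (by norm_num)) s u
  rw [Nat.cast_ofNat] at h
  rw [h]
  have hodd : ∀ v : ZMod (2 ^ 3), v = toZModPow 3 u → v = 1 ∨ v = 3 ∨ v = 5 ∨ v = 7 := by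
    intro v hv
    have h4 : 4 * v ≠ 0 := by
      intro h4
      have : toZModPow 3 (4 * u) = 0 := by rw [map_mul, ← hv, map_ofNat, h4]
      rw [← RingHom.mem_ker, ker_toZModPow, Ideal.mem_span_singleton] at this
      obtain ⟨k, hk⟩ := this
      refine hu ⟨k, mul_left_cancel₀ (pow_ne_zero 2 hP.ne_zero) ?_⟩
      push_cast at hk
      linear_combination hk
    clear hv
    revert v; decide
  obtain ⟨t, ht⟩ := (isUnit_of_toZMod_ne_zero h7).exists_right_inv
  rcases Nat.mod_two_eq_zero_or_one s with hs | hs <;> rw [hs]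
  · constructor
    · rintro ⟨x, y, h⟩
      have h' := congrArg (toZModPow 3) h
      simp only [map_add, map_mul, map_pow, pow_zero, one_mul, map_ofNat] at h'
      have h'' := hodd _ rfl
      generalize toZModPow 3 x = a at *
      generalize toZModPow 3 y = b at *
      generalize toZModPow 3 u = c at *
      clear h hodd
      revert a b c; decide
    · rintro (h | h)
      · obtain ⟨z, hz⟩ := exists_sq_eq_of_toZModPow_three h
        exact ⟨z, 0, by simp [hz]⟩
      · obtain ⟨z, hz⟩ := exists_sq_eq_of_toZModPow_three (u := u - 14) (by simp [map_ofNat, h]; decide)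
        exact ⟨z, 1, by simp [hz]⟩
  · constructor
    · rintro ⟨x, y, h⟩
      obtain ⟨x, rfl⟩ : (2 : ℤ_[2]) ∣ x := hP.dvd_of_dvd_pow (n := 2)
        ⟨u - 7 * y ^ 2, by linear_combination h⟩
      replace h : 2 * x ^ 2 + 7 * y ^ 2 = u :=
        mul_left_cancel₀ hP.ne_zero (by linear_combination h)
      have h' := congrArg (toZModPow 3) h
      simp only [map_add, map_mul, map_pow, map_ofNat] at h'
      have h'' := hodd _ rfl
      generalize toZModPow 3 x = a at *
      generalize toZModPow 3 y = b at *
      generalize toZModPow 3 u = c at *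
      clear h hodd
      revert a b c; decide
    · rintro (h | h)
      · obtain ⟨z, hz⟩ := exists_sq_eq_of_toZModPow_three (u := 7 * (u - 2))
          (by simp [map_ofNat, h]; decide)
        exact ⟨2, t * z, by linear_combination 14 * t ^ 2 * hz + 2 * (7 * t + 1) * (u - 2) * ht⟩
      · obtain ⟨z, hz⟩ := exists_sq_eq_of_toZModPow_three (u := 7 * u) (by simp [map_ofNat, h]; decide)
        exact ⟨0, t * z, by linear_combination 14 * t ^ 2 * hz + 2 * (7 * t + 1) * u * ht⟩

instance fact_prime_seven : Fact (Nat.Prime 7) := ⟨by norm_num⟩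

lemma seven_exists_sq_add_iff (s : ℕ) {u : ℤ_[7]} (hu : toZMod u ≠ 0) :
    (∃ x y : ℤ_[7], x ^ 2 + 14 * y ^ 2 = 7 ^ s * u) ↔ IsSquare (toZMod u) := by
  have hP : Prime (7 : ℤ_[7]) := by simpa using prime_p (p := 7)
  have h2 : toZMod (2 : ℤ_[7]) ≠ 0 := by rw [map_ofNat]; decide
  have h := exists_sq_add_iff_mod_two (p := 7) (dvd_of_sq_dvd_sq_add (c := 2)
    (by rwa [← toZMod_eq_zero_iff_dvd]) (by norm_num)) s u
  rw [Nat.cast_ofNat] at h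
  rw [h]
  obtain ⟨t, ht⟩ := (isUnit_of_toZMod_ne_zero h2).exists_right_inv
  have h7 : (7 : ZMod 7) = 0 := by decide
  have h14 : (14 : ZMod 7) = 0 := by decide
  rcases Nat.mod_two_eq_zero_or_one s with hs | hs <;> rw [hs]
  · constructor
    · rintro ⟨x, y, h⟩
      refine ⟨toZMod x, ?_⟩
      have h' := congrArg toZMod h
      simp [map_ofNat, h14] at h'
      rw [← h', sq]
    · intro h
      obtain ⟨z, hz⟩ := exists_sq_eq_of_toZMod (by norm_num) hu h
      exact ⟨z, 0, by simp [hz]⟩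
  · constructor
    · rintro ⟨x, y, h⟩
      obtain ⟨x, rfl⟩ : (7 : ℤ_[7]) ∣ x := hP.dvd_of_dvd_pow (n := 2)
        ⟨u - 2 * y ^ 2, by linear_combination h⟩
      replace h : 7 * x ^ 2 + 2 * y ^ 2 = u :=
        mul_left_cancel₀ hP.ne_zero (by linear_combination h)
      refine ⟨3 * toZMod y, ?_⟩
      have h' := congrArg toZMod h
      simp [map_ofNat, h7] at h'
      rw [← h']
      linear_combination (-toZMod y ^ 2) * h7
    · rintro ⟨r, hr⟩
      obtain ⟨z, hz⟩ := exists_sq_eq_of_toZMod (u := 2 * u) (by norm_num)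
        (by simp only [map_mul]; exact mul_ne_zero h2 hu)
        ⟨3 * r, by simp [map_ofNat, hr]; linear_combination (-r ^ 2) * h7⟩
      exact ⟨0, t * z, by linear_combination 14 * t ^ 2 * hz + 7 * (2 * t + 1) * u * ht⟩

lemma exists_sq_add_iff_of_ne (h2 : p ≠ 2) (h7 : p ≠ 7) (s : ℕ) {u : ℤ_[p]} (hu : toZMod u ≠ 0) :
    (∃ x y : ℤ_[p], x ^ 2 + 14 * y ^ 2 = p ^ s * u) ↔ (Odd s → IsSquare (-14 : ZMod p)) := by
  have hP := prime_p (p := p)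
  have h2' : (2 : ZMod p) ≠ 0 := mod_cast ZMod.natCast_ne_zero_of_prime_ne Nat.prime_two h2
  have h7' : (7 : ZMod p) ≠ 0 := mod_cast ZMod.natCast_ne_zero_of_prime_ne (q := 7) (by norm_num) h7
  have h14 : (14 : ZMod p) ≠ 0 := by
    rw [show (14 : ZMod p) = 2 * 7 by norm_num]; exact mul_ne_zero h2' h7'
  by_cases hsq : IsSquare (-14 : ZMod p)
  · simp only [hsq, implies_true, iff_true]
    generalize (p : ℤ_[p]) ^ s * u = N
    obtain ⟨d, hd⟩ := exists_sq_eq_of_toZMod (u := -14) h2 (by simpa [map_ofNat] using h14)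
      (by simpa [map_ofNat] using hsq)
    have hd0 : toZMod (2 * d) ≠ 0 := by
      intro h
      have := congrArg toZMod hd
      simp [map_ofNat, h2'] at h
      simp [map_ofNat, h, h14] at this
    obtain ⟨t, ht⟩ := (isUnit_of_toZMod_ne_zero hd0).exists_right_inv
    exact ⟨d * t * (1 + N), t * (N - 1), by
      linear_combination t ^ 2 * (N - 1) ^ 2 * hd + N * (2 * d * t + 1) * ht⟩
  · have hdvd : ∀ x y : ℤ_[p], (p : ℤ_[p]) ∣ x ^ 2 + 14 * y ^ 2 →
        (p : ℤ_[p]) ∣ x ∧ (p : ℤ_[p]) ∣ y := by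
      intro x y h
      simp only [← toZMod_eq_zero_iff_dvd, map_add, map_mul, map_pow, map_ofNat] at h ⊢
      have hy : toZMod y = 0 := by
        by_contra hy
        refine hsq ⟨toZMod x / toZMod y, ?_⟩
        field_simp
        linear_combination -h
      refine ⟨?_, hy⟩
      simpa [hy] using h
    rw [exists_sq_add_iff_mod_two (fun x y h ↦ hdvd x y ((dvd_pow_self _ two_ne_zero).trans h))]
    rcases Nat.mod_two_eq_zero_or_one s with hs | hs <;> rw [hs]
    · simp only [Nat.not_odd_iff.2 hs, false_implies, iff_true, pow_zero, one_mul]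
      obtain ⟨a, b, hab⟩ := FiniteField.exists_root_sum_quadratic
        (f := (Polynomial.X ^ 2 - Polynomial.C (toZMod u) : Polynomial (ZMod p)))
        (g := Polynomial.C 14 * Polynomial.X ^ 2)
        (Polynomial.degree_X_pow_sub_C (by decide) _) (Polynomial.degree_C_mul_X_pow 2 h14)
        (by rw [ZMod.card]; exact (Fact.out : p.Prime).eq_two_or_odd.resolve_left h2)
      simp only [Polynomial.eval_sub, Polynomial.eval_pow, Polynomial.eval_X, Polynomial.eval_C,
        Polynomial.eval_mul] at hab
      by_cases ha : a = 0
      · obtain ⟨t, ht⟩ := (isUnit_of_toZMod_ne_zero (x := (14 : ℤ_[p]))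
          (by simpa [map_ofNat] using h14)).exists_right_inv
        obtain ⟨z, hz⟩ := exists_sq_eq_of_toZMod (u := 14 * u) h2 (by simp [map_ofNat, h14, hu])
          ⟨14 * b, by simp [map_ofNat]; linear_combination (-14) * hab + 14 * a * ha⟩
        exact ⟨0, t * z, by linear_combination 14 * t ^ 2 * hz + (14 * t + 1) * u * ht⟩
      · obtain ⟨y, rfl⟩ := ZMod.ringHom_surjective (toZMod (p := p)) b
        have key : toZMod (u - 14 * y ^ 2) = a * a := by simp [map_ofNat]; linear_combination -hab
        obtain ⟨z, hz⟩ := exists_sq_eq_of_toZMod (u := u - 14 * y ^ 2) h2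
          (by rw [key]; exact mul_ne_zero ha ha) ⟨a, key⟩
        exact ⟨z, y, by rw [hz]; ring⟩
    · simp only [Nat.odd_iff.2 hs, hsq, forall_const, iff_false, pow_one]
      rintro ⟨x, y, h⟩
      obtain ⟨⟨x, rfl⟩, ⟨y, rfl⟩⟩ := hdvd x y ⟨u, h⟩
      refine hu (toZMod_eq_zero_iff_dvd.2 ⟨x ^ 2 + 14 * y ^ 2, mul_left_cancel₀ hP.ne_zero ?_⟩)
      linear_combination -h

lemma three_exists_form (g : ℤ_[3]) :
    ∃ x y : ℤ_[3], 3 * x ^ 2 + 2 * x * y + 5 * y ^ 2 + g = 0 := by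
  have h3 : (3 : ZMod 3) = 0 := by decide
  have key : toZMod (1 - 3 * (5 + g)) = 1 := by simp [map_ofNat, h3]
  obtain ⟨d, hd⟩ := exists_sq_eq_of_toZMod (u := 1 - 3 * (5 + g)) (by norm_num)
    (by rw [key]; exact one_ne_zero) ⟨1, by rw [key, mul_one]⟩
  have h0 : (3 : ℤ_[3]) ≠ 0 := by norm_num
  have hroot : ∀ e : ℤ_[3], e ^ 2 = 1 - 3 * (5 + g) → toZMod e = 1 →
      ∃ x y : ℤ_[3], 3 * x ^ 2 + 2 * x * y + 5 * y ^ 2 + g = 0 := by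
    intro e he h1
    obtain ⟨x, hx⟩ : ((3 : ℕ) : ℤ_[3]) ∣ e - 1 := toZMod_eq_zero_iff_dvd.1 (by simp [h1])
    push_cast at hx
    refine ⟨x, 1, mul_left_cancel₀ h0 ?_⟩
    linear_combination he - (e + 3 * x + 1) * hx
  have hd1 : toZMod d = 1 ∨ toZMod d = -1 := by
    rw [← sq_eq_one_iff, ← map_pow, hd, key]
  rcases hd1 with h | h
  · exact hroot d hd h
  · exact hroot (-d) (by simpa using hd) (by simp [h])

end PadicInt

lemma Int.eq_pow_padicValInt_mul {p : ℕ} (hp : p.Prime) {g : ℤ} (hg : g ≠ 0) :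
    g = p ^ padicValInt p g * (g / p ^ padicValInt p g) ∧
      ¬ (p : ℤ) ∣ g / p ^ padicValInt p g := by
  have := Fact.mk hp
  have h := (Int.mul_ediv_cancel' (padicValInt_dvd (p := p) g)).symm
  refine ⟨h, fun ⟨k, hk⟩ ↦ ?_⟩
  have hd : (p : ℤ) ^ (padicValInt p g + 1) ∣ g :=
    ⟨k, by rw [hk] at h; rw [pow_succ, mul_assoc]; exact h⟩
  rw [padicValInt_dvd_iff] at hd
  omega

lemma ZMod.intCast_ne_zero_of_not_dvd {p : ℕ} {a : ℤ} (h : ¬ (p : ℤ) ∣ a) : (a : ZMod p) ≠ 0 := by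
  rwa [Ne, ZMod.intCast_zmod_eq_zero_iff_dvd]

namespace PadicInt

lemma two_exists_form_iff {g : ℤ} (hg : g ≠ 0) {s : ℕ} (hs : s = padicValInt 2 g) :
    (∃ x y : ℤ_[2], 3 * x ^ 2 + 2 * x * y + 5 * y ^ 2 + (g : ℤ_[2]) = 0) ↔
      ((3 * g / 2 ^ s) % 8 = 1 ∨ (3 * g / 2 ^ s) % 8 = 7) := by
  obtain ⟨h, hw⟩ := Int.eq_pow_padicValInt_mul Nat.prime_two hg
  rw [← hs] at h hw
  push_cast at h hw
  have hdiv : 3 * g / 2 ^ s = 3 * (g / 2 ^ s) :=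
    Int.mul_ediv_assoc 3 ⟨_, h⟩
  rw [hdiv]
  generalize g / 2 ^ s = w at *
  rw [exists_form_iff_exists_sq_add (by norm_num)]
  have hN : -3 * (g : ℤ_[2]) = 2 ^ s * ((-3 * w : ℤ) : ℤ_[2]) := by
    rw [h]; push_cast; ring
  have hu : ¬ (2 : ℤ_[2]) ∣ ((-3 * w : ℤ) : ℤ_[2]) := by
    have := toZMod_eq_zero_iff_dvd (p := 2) (x := ((-3 * w : ℤ) : ℤ_[2]))
    rw [Nat.cast_ofNat] at this
    rw [← this, map_intCast]
    exact ZMod.intCast_ne_zero_of_not_dvd (by push_cast; omega)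
  have h1 : ((-3 * w : ℤ) : ZMod (2 ^ 3)) = 1 ↔ (-3 * w) % 8 = 1 := by
    have := ZMod.intCast_eq_intCast_iff' (-3 * w) 1 (2 ^ 3)
    simpa using this
  have h7 : ((-3 * w : ℤ) : ZMod (2 ^ 3)) = 7 ↔ (-3 * w) % 8 = 7 := by
    have := ZMod.intCast_eq_intCast_iff' (-3 * w) 7 (2 ^ 3)
    simpa using this
  rw [hN, two_exists_sq_add_iff s hu, map_intCast, h1, h7]
  omega

lemma seven_exists_form_iff {g : ℤ} (hg : g ≠ 0) {s : ℕ} (hs : s = padicValInt 7 g) :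
    (∃ x y : ℤ_[7], 3 * x ^ 2 + 2 * x * y + 5 * y ^ 2 + (g : ℤ_[7]) = 0) ↔
      legendreSym 7 (g / 7 ^ s) = 1 := by
  obtain ⟨h, hw⟩ := Int.eq_pow_padicValInt_mul (p := 7) Fact.out hg
  rw [← hs] at h hw
  have hw0 := ZMod.intCast_ne_zero_of_not_dvd hw
  push_cast at h hw0
  rw [legendreSym.eq_one_iff 7 hw0]
  generalize g / 7 ^ s = w at *
  rw [exists_form_iff_exists_sq_add (by norm_num)]
  have hN : -3 * (g : ℤ_[7]) = 7 ^ s * ((-3 * w : ℤ) : ℤ_[7]) := by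
    rw [h]; push_cast; ring
  have h4 : ((-3 * w : ℤ) : ZMod 7) = 2 ^ 2 * (w : ZMod 7) := by
    have h7 : (7 : ZMod 7) = 0 := by decide
    push_cast
    linear_combination (-w : ZMod 7) * h7
  rw [hN, seven_exists_sq_add_iff s] <;> rw [map_intCast, h4]
  · have h7 : (7 : ZMod 7) = 0 := by decide
    refine ⟨fun ⟨r, hr⟩ ↦ ⟨4 * r, ?_⟩, fun h ↦ (IsSquare.sq 2).mul h⟩
    linear_combination 16 * hr - 9 * (w : ZMod 7) * h7
  · exact mul_ne_zero (by decide) hw0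

lemma exists_form_iff_of_ne {p : ℕ} [Fact p.Prime] {g : ℤ} (hg : g ≠ 0) (h2 : p ≠ 2) (h3 : p ≠ 3)
    (h7 : p ≠ 7) :
    (∃ x y : ℤ_[p], 3 * x ^ 2 + 2 * x * y + 5 * y ^ 2 + (g : ℤ_[p]) = 0) ↔
      (Odd (padicValInt p g) → legendreSym p (-14) = 1) := by
  obtain ⟨h, hw⟩ := Int.eq_pow_padicValInt_mul (p := p) Fact.out hg
  generalize padicValInt p g = s at *
  generalize g / p ^ s = w at *
  have hN : -3 * (g : ℤ_[p]) = p ^ s * ((-3 * w : ℤ) : ℤ_[p]) := by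
    rw [h]; push_cast; ring
  have h2' : (2 : ZMod p) ≠ 0 := mod_cast ZMod.natCast_ne_zero_of_prime_ne Nat.prime_two h2
  have h3' : (3 : ZMod p) ≠ 0 := mod_cast ZMod.natCast_ne_zero_of_prime_ne Nat.prime_three h3
  have h7' : (7 : ZMod p) ≠ 0 := mod_cast ZMod.natCast_ne_zero_of_prime_ne (q := 7) (by norm_num) h7
  have h14 : ((-14 : ℤ) : ZMod p) ≠ 0 := by
    rw [show ((-14 : ℤ) : ZMod p) = -(2 * 7) by norm_num]
    exact neg_ne_zero.2 (mul_ne_zero h2' h7')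
  rw [exists_form_iff_exists_sq_add h3, hN, exists_sq_add_iff_of_ne h2 h7 s,
    legendreSym.eq_one_iff p h14]
  · push_cast; rfl
  · rw [map_intCast]
    push_cast
    exact mul_ne_zero (neg_ne_zero.2 h3') (ZMod.intCast_ne_zero_of_not_dvd hw)

end PadicInt

/-- Local solvability criterion for `3x² + 2xy + 5y² + g = 0` with `g < 0`:
it is solvable in `ℤ_p` for every prime `p` iff the three listed conditions hold. -/
theorem locally_solvable_3_2_5_iff (g : ℤ) (hg : g < 0)
    (s1 s2 : ℕ) (hs1 : s1 = padicValInt 2 g) (hs2 : s2 = padicValInt 7 g) :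
    (∀ (p : ℕ) (hp : p.Prime),
      letI : Fact p.Prime := ⟨hp⟩
      ∃ x y : ℤ_[p], 3 * x ^ 2 + 2 * x * y + 5 * y ^ 2 + (g : ℤ_[p]) = 0) ↔
      ((3 * g / 2 ^ s1) % 8 = 1 ∨ (3 * g / 2 ^ s1) % 8 = 7) ∧
      @legendreSym 7 ⟨by norm_num⟩ (g / 7 ^ s2) = 1 ∧
      (∀ p : ℕ, ∀ hp : p.Prime, p ≠ 2 → p ≠ 3 → p ≠ 7 →
        Odd (padicValInt p g) → @legendreSym p ⟨hp⟩ (-14) = 1) := by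
  have two : (∃ x y : ℤ_[2], 3 * x ^ 2 + 2 * x * y + 5 * y ^ 2 + (g : ℤ_[2]) = 0) ↔
      ((3 * g / 2 ^ s1) % 8 = 1 ∨ (3 * g / 2 ^ s1) % 8 = 7) := PadicInt.two_exists_form_iff hg.ne hs1
  have seven : (∃ x y : ℤ_[7], 3 * x ^ 2 + 2 * x * y + 5 * y ^ 2 + (g : ℤ_[7]) = 0) ↔
      legendreSym 7 (g / 7 ^ s2) = 1 := PadicInt.seven_exists_form_iff hg.ne hs2
  rw [← two, ← seven]
  constructor
  · intro h
    refine ⟨h 2 Nat.prime_two, h 7 (by norm_num), fun p hp h2 h3 h7 ↦ ?_⟩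
    have := Fact.mk hp
    exact (PadicInt.exists_form_iff_of_ne hg.ne h2 h3 h7).1 (h p hp)
  · rintro ⟨H2, H7, H⟩ p hp
    have := Fact.mk hp
    by_cases h2 : p = 2
    · subst h2; exact H2
    by_cases h3 : p = 3
    · subst h3; exact PadicInt.three_exists_form _
    by_cases h7 : p = 7
    · subst h7; exact H7
    exact (PadicInt.exists_form_iff_of_ne hg.ne h2 h3 h7).2 (H p hp h2 h3 h7)
end

section
/- Let g be a nonzero integer and let s_2 = v_79(g). Then the equation 5x^2 + 14xy - 6y^2 + g = 0 has a solution with x, y in the ring ℤ_p of p-adic integers for every prime p if and only if both of the following hold: (1) the Legendre symbol ((-1)^{s_2}·g·79^{-s_2}/79) = -1; (2) for every prime p ∉ {2,5,79} such that v_p(g) is odd, the Legendre symbol (79/p) = 1. -/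
theorem PadicInt.toZMod_eq_zero_iff_dvd_s7 {p : ℕ} [Fact p.Prime] {z : ℤ_[p]} :
    PadicInt.toZMod z = 0 ↔ (p : ℤ_[p]) ∣ z := by
  rw [← RingHom.mem_ker, PadicInt.ker_toZMod, PadicInt.maximalIdeal_eq_span_p,
    Ideal.mem_span_singleton]

open Polynomial in
/-- Hensel's lemma for a quadratic polynomial over `ℤ_[p]`. -/
theorem PadicInt.exists_root_quadratic {p : ℕ} [Fact p.Prime] (a b c x : ℤ_[p])
    (h : ‖a * x ^ 2 + b * x + c‖ < ‖2 * a * x + b‖ ^ 2) :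
    ∃ z : ℤ_[p], a * z ^ 2 + b * z + c = 0 := by
  have hd : (C a * X ^ 2 + C b * X + C c : ℤ_[p][X]).derivative.aeval x = 2 * a * x + b := by
    simp
    ring
  obtain ⟨z, hz, -⟩ := hensels_lemma (p := p) (R := ℤ_[p])
    (F := C a * X ^ 2 + C b * X + C c) (a := x) (by rw [hd]; simpa using h)
  exact ⟨z, by simpa using hz⟩

/-- Solvability of `5x² + 14xy - 6y² + c = 0` in the ring `R`. -/
def FormSolvable {R : Type*} [CommRing R] (c : R) : Prop :=
  ∃ x y : R, 5 * x ^ 2 + 14 * x * y - 6 * y ^ 2 + c = 0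

namespace FormSolvable

section CommRing

variable {R : Type*} [CommRing R] {c : R}

theorem sq_mul (h : FormSolvable c) (d : R) : FormSolvable (d ^ 2 * c) := by
  obtain ⟨x, y, h⟩ := h
  exact ⟨d * x, d * y, by linear_combination d ^ 2 * h⟩

theorem two_mul (h : FormSolvable c) : FormSolvable (2 * c) := by
  obtain ⟨x, y, h⟩ := h
  exact ⟨2 * x + 6 * y, 5 * x + 16 * y, by linear_combination 2 * h⟩

theorem two_pow_mul (h : FormSolvable c) (n : ℕ) : FormSolvable (2 ^ n * c) := by
  induction n with
  | zero => simpa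
  | succ n ih => rw [pow_succ', mul_assoc]; exact ih.two_mul

theorem neg_79_mul (h : FormSolvable c) : FormSolvable (-79 * c) := by
  obtain ⟨x, y, h⟩ := h
  exact ⟨6 * y - 7 * x, 5 * x + 7 * y, by linear_combination (-79) * h⟩

theorem neg_79_pow_mul (h : FormSolvable c) (n : ℕ) : FormSolvable ((-79) ^ n * c) := by
  induction n with
  | zero => simpa
  | succ n ih => rw [pow_succ', mul_assoc]; exact ih.neg_79_mul

end CommRing

section Padic

variable {p : ℕ} [Fact p.Prime]

theorem of_dvd (x y g : ℤ) (h : (p : ℤ) ∣ 5 * x ^ 2 + 14 * x * y - 6 * y ^ 2 + g)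
    (hxy : ¬ (p : ℤ) ∣ 10 * x + 14 * y ∨ ¬ (p : ℤ) ∣ 14 * x - 12 * y) :
    FormSolvable (g : ℤ_[p]) := by
  have unit {k : ℤ} (hk : ¬ (p : ℤ) ∣ k) : ‖(k : ℤ_[p])‖ = 1 :=
    le_antisymm (PadicInt.norm_le_one _)
      (not_lt.1 fun hlt ↦ hk ((PadicInt.norm_int_lt_one_iff_dvd k).1 hlt))
  have h0 := (PadicInt.norm_int_lt_one_iff_dvd (p := p) _).2 h
  rcases hxy with hx | hy
  · have h1 := unit hx
    obtain ⟨z, hz⟩ := PadicInt.exists_root_quadratic (5 : ℤ_[p]) (14 * y) (-6 * y ^ 2 + g) x (by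
      rw [show (2 * 5 * x + 14 * y : ℤ_[p]) = ((10 * x + 14 * y : ℤ) : ℤ_[p]) by push_cast; ring,
        h1, one_pow]
      convert h0 using 2
      push_cast
      ring)
    exact ⟨z, y, by linear_combination hz⟩
  · have h1 := unit hy
    obtain ⟨z, hz⟩ := PadicInt.exists_root_quadratic (-6 : ℤ_[p]) (14 * x) (5 * x ^ 2 + g) y (by
      rw [show (2 * -6 * y + 14 * x : ℤ_[p]) = ((14 * x - 12 * y : ℤ) : ℤ_[p]) by push_cast; ring,
        h1, one_pow]
      convert h0 using 2
      push_cast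
      ring)
    exact ⟨x, z, by linear_combination hz⟩

end Padic

theorem at_two {m : ℤ} (hm : m % 4 = 3) : FormSolvable (m : ℤ_[2]) := by
  have key (c : ℤ) (hc : ¬ (2 : ℤ) ∣ c) (hcm : (8 : ℤ) ∣ c + m) :
      ∃ z : ℤ_[2], c * z ^ 2 + m = 0 := by
    have hc1 : ‖(c : ℤ_[2])‖ = 1 :=
      le_antisymm (PadicInt.norm_le_one _)
        (not_lt.1 fun hlt ↦ hc (by exact_mod_cast (PadicInt.norm_int_lt_one_iff_dvd c).1 hlt))
    have h2 : ‖(2 : ℤ_[2])‖ = 2⁻¹ := by simpa using PadicInt.norm_p (p := 2)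
    have h8 : ‖((c + m : ℤ) : ℤ_[2])‖ ≤ (2 : ℝ) ^ (-3 : ℤ) := by
      have := (PadicInt.norm_int_le_pow_iff_dvd (p := 2) (k := c + m) (n := 3)).2 (by simpa using hcm)
      simpa using this
    obtain ⟨z, hz⟩ := PadicInt.exists_root_quadratic (c : ℤ_[2]) 0 m 1 (by
      rw [show (2 * c * 1 + 0 : ℤ_[2]) = 2 * c by ring, norm_mul, hc1, h2,
        show (c * 1 ^ 2 + 0 * 1 + m : ℤ_[2]) = ((c + m : ℤ) : ℤ_[2]) by push_cast; ring]
      exact h8.trans_lt (by norm_num))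
    exact ⟨z, by linear_combination hz⟩
  rcases (by omega : (8 : ℤ) ∣ 5 + m ∨ (8 : ℤ) ∣ 9 + m) with h | h
  · obtain ⟨z, hz⟩ := key 5 (by norm_num) h
    exact ⟨z, 0, by push_cast at hz; linear_combination hz⟩
  · obtain ⟨z, hz⟩ := key 9 (by norm_num) h
    exact ⟨z, 2 * z, by push_cast at hz; linear_combination hz⟩

theorem at_five [Fact (Nat.Prime 5)] (g : ℤ) : FormSolvable (g : ℤ_[5]) :=
  of_dvd (4 - 4 * g) 1 g ⟨16 * (1 - g) ^ 2 + 10 - 11 * g, by push_cast; ring⟩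
    (.inl (by push_cast; omega))

theorem at_79_iff [Fact (Nat.Prime 79)] {h : ℤ} (hh : ¬ (79 : ℤ) ∣ h) :
    FormSolvable (h : ℤ_[79]) ↔ legendreSym 79 h = -1 := by
  have h0 : (h : ZMod 79) ≠ 0 := by rwa [Ne, ZMod.intCast_zmod_eq_zero_iff_dvd]
  have h5 : legendreSym 79 (-5 * h) = 1 ↔ legendreSym 79 h = -1 := by
    rw [legendreSym.mul, show legendreSym 79 (-5) = -1 by norm_num]
    constructor <;> intro <;> linarith
  have hne : ((-5 * h : ℤ) : ZMod 79) ≠ 0 := by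
    rw [Int.cast_mul]
    refine mul_ne_zero ?_ h0
    rw [Ne, ZMod.intCast_zmod_eq_zero_iff_dvd]
    norm_num
  rw [← h5, legendreSym.eq_one_iff 79 hne]
  constructor
  · rintro ⟨x, y, e⟩
    have e' := congrArg (PadicInt.toZMod (p := 79)) e
    simp only [map_add, map_sub, map_mul, map_pow, map_ofNat, map_intCast, map_zero] at e'
    have h79 : (79 : ZMod 79) = 0 := by exact_mod_cast ZMod.natCast_self 79
    refine ⟨5 * PadicInt.toZMod x + 7 * PadicInt.toZMod y, ?_⟩
    push_cast
    linear_combination (-5) * e' - PadicInt.toZMod y ^ 2 * h79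
  · rintro ⟨u, hu⟩
    obtain ⟨t, ht⟩ := ZMod.intCast_surjective (16 * u)
    have h79 : (79 : ZMod 79) = 0 := by exact_mod_cast ZMod.natCast_self 79
    push_cast at hu
    have hz : ((5 * t ^ 2 + h : ℤ) : ZMod 79) = 0 := by
      push_cast
      rw [ht]
      linear_combination (-1280) * hu + (-81 * h) * h79
    refine of_dvd t 0 h ?_ (.inl ?_)
    · rw [← ZMod.intCast_zmod_eq_zero_iff_dvd, ← hz]
      push_cast
      ring
    · intro hd
      have h1 : (79 : ℤ) ∣ t := by push_cast at hd; omega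
      rw [ZMod.intCast_zmod_eq_zero_iff_dvd] at hz
      push_cast at hz
      exact hh ((Int.dvd_add_right ((h1.pow two_ne_zero).mul_left 5)).1 hz)

theorem of_neg_79_mul [Fact (Nat.Prime 79)] {c : ℤ_[79]} (h : FormSolvable (-79 * c)) :
    FormSolvable c := by
  obtain ⟨x, y, e⟩ := h
  have h79 : (79 : ZMod 79) = 0 := by exact_mod_cast ZMod.natCast_self 79
  have hu : PadicInt.toZMod (5 * x + 7 * y) = 0 := by
    have e' := congrArg (PadicInt.toZMod (p := 79)) e
    simp only [map_add, map_sub, map_neg, map_mul, map_pow, map_ofNat, map_zero] at e'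
    rw [← sq_eq_zero_iff]
    simp only [map_add, map_mul, map_ofNat]
    linear_combination 5 * e' + (PadicInt.toZMod y ^ 2 + 5 * PadicInt.toZMod c) * h79
  obtain ⟨w, hw⟩ := PadicInt.toZMod_eq_zero_iff_dvd_s7.1 hu
  push_cast at hw
  have h0 : (79 : ℤ_[79]) ≠ 0 := by norm_num
  refine ⟨10 * y - 112 * w + 7 * x, w, mul_left_cancel₀ h0 (mul_left_cancel₀ h0 ?_)⟩
  have hx : 79 * (10 * y - 112 * w + 7 * x) = 6 * y - 7 * x := by linear_combination 112 * hw
  generalize 10 * y - 112 * w + 7 * x = z at hx ⊢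
  linear_combination (5 * (79 * z + 6 * y - 7 * x) + 14 * 79 * w) * hx -
    (14 * (6 * y - 7 * x) - 6 * (79 * w + 5 * x + 7 * y)) * hw - 79 * e

theorem neg_79_pow_mul_iff [Fact (Nat.Prime 79)] {c : ℤ_[79]} (n : ℕ) :
    FormSolvable ((-79) ^ n * c) ↔ FormSolvable c := by
  refine ⟨fun h ↦ ?_, fun h ↦ h.neg_79_pow_mul n⟩
  induction n with
  | zero => simpa using h
  | succ n ih => rw [pow_succ', mul_assoc] at h; exact ih h.of_neg_79_mul

section Padic

variable {p : ℕ} [Fact p.Prime]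

theorem of_not_dvd (hp2 : p ≠ 2) (hp5 : (5 : ZMod p) ≠ 0) (hp79 : (79 : ZMod p) ≠ 0)
    {h : ℤ} (hh : ¬ (p : ℤ) ∣ h) : FormSolvable (h : ℤ_[p]) := by
  have hodd : Fintype.card (ZMod p) % 2 = 1 := by
    rw [ZMod.card]
    exact (Fact.out : p.Prime).eq_two_or_odd.resolve_left hp2
  obtain ⟨u, v, huv⟩ := FiniteField.exists_root_sum_quadratic (R := ZMod p)
    (f := .C 1 * .X ^ 2 + .C 0 * .X + .C 0) (g := .C (-79) * .X ^ 2 + .C 0 * .X + .C (5 * h))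
    (Polynomial.degree_quadratic one_ne_zero) (Polynomial.degree_quadratic (neg_ne_zero.2 hp79))
    hodd
  obtain ⟨x, hx⟩ := ZMod.intCast_surjective ((u - 7 * v) / 5)
  obtain ⟨y, rfl⟩ := ZMod.intCast_surjective v
  have hx' : (5 * x + 7 * y : ZMod p) = u := by
    rw [hx, mul_div_cancel₀ _ hp5, sub_add_cancel]
  have hd : (p : ℤ) ∣ 5 * x ^ 2 + 14 * x * y - 6 * y ^ 2 + h := by
    rw [← ZMod.intCast_zmod_eq_zero_iff_dvd]
    refine mul_left_cancel₀ hp5 ?_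
    simp only [Polynomial.eval_add, Polynomial.eval_mul, Polynomial.eval_C, Polynomial.eval_pow,
      Polynomial.eval_X, ← hx'] at huv
    push_cast
    linear_combination huv
  refine of_dvd x y h hd ?_
  by_contra! hg
  have h2 : (p : ℤ) ∣ 2 * h := by
    rw [show 2 * h = 2 * (5 * x ^ 2 + 14 * x * y - 6 * y ^ 2 + h) -
      (x * (10 * x + 14 * y) + y * (14 * x - 12 * y)) by ring]
    exact (hd.mul_left 2).sub ((hg.1.mul_left x).add (hg.2.mul_left y))
  rcases (Nat.prime_iff_prime_int.1 (Fact.out : p.Prime)).dvd_or_dvd h2 with h3 | h3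
  · exact hp2 ((Nat.prime_dvd_prime_iff_eq Fact.out Nat.prime_two).1 (by exact_mod_cast h3))
  · exact hh h3

theorem of_isSquare (hp2 : p ≠ 2) (hp5 : (5 : ZMod p) ≠ 0) (hp79 : (79 : ZMod p) ≠ 0)
    (hsq : IsSquare (79 : ZMod p)) {g : ℤ} (hg : (p : ℤ) ∣ g) : FormSolvable (g : ℤ_[p]) := by
  obtain ⟨t, ht⟩ := hsq
  obtain ⟨x, hx⟩ := ZMod.intCast_surjective ((t - 7) / 5)
  have hx' : (5 * x + 7 : ZMod p) = t := by
    rw [hx, mul_div_cancel₀ _ hp5, sub_add_cancel]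
  refine of_dvd x 1 g ((Int.dvd_add_left hg).2 ?_) (.inl fun hd ↦ ?_)
  · rw [← ZMod.intCast_zmod_eq_zero_iff_dvd]
    refine mul_left_cancel₀ hp5 ?_
    rw [← hx'] at ht
    push_cast
    linear_combination -ht
  · rw [← ZMod.intCast_zmod_eq_zero_iff_dvd] at hd
    push_cast at hd
    have h2 : (2 : ZMod p) ≠ 0 := by
      intro h
      exact hp2 ((Nat.prime_dvd_prime_iff_eq Fact.out Nat.prime_two).1
        ((ZMod.natCast_eq_zero_iff 2 p).1 (by exact_mod_cast h)))
    have ht0 : t = 0 := by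
      refine mul_left_cancel₀ h2 ?_
      rw [← hx']
      linear_combination hd
    exact hp79 (by rw [ht, ht0, mul_zero])

theorem descent (hp5 : (5 : ZMod p) ≠ 0) (hsq : ¬ IsSquare (79 : ZMod p)) {c : ℤ_[p]}
    (h : FormSolvable (p * c)) : ∃ d, c = p * d ∧ FormSolvable d := by
  obtain ⟨x, y, e⟩ := h
  have e' := congrArg (PadicInt.toZMod (p := p)) e
  simp only [map_add, map_sub, map_mul, map_pow, map_ofNat, map_zero, map_natCast,
    CharP.cast_eq_zero, zero_mul, add_zero] at e'
  have hy : PadicInt.toZMod y = 0 := by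
    by_contra hy
    refine hsq ⟨(5 * PadicInt.toZMod x + 7 * PadicInt.toZMod y) / PadicInt.toZMod y, ?_⟩
    field_simp
    linear_combination (-5) * e'
  have hx : PadicInt.toZMod x = 0 := by
    rw [hy] at e'
    have h0 : 5 * PadicInt.toZMod x ^ 2 = 0 := by linear_combination e'
    simpa [hp5] using h0
  obtain ⟨x, rfl⟩ := PadicInt.toZMod_eq_zero_iff_dvd_s7.1 hx
  obtain ⟨y, rfl⟩ := PadicInt.toZMod_eq_zero_iff_dvd_s7.1 hy
  have hp0 : (p : ℤ_[p]) ≠ 0 := by exact_mod_cast (Fact.out : p.Prime).ne_zero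
  exact ⟨-(5 * x ^ 2 + 14 * x * y - 6 * y ^ 2),
    mul_left_cancel₀ hp0 (by linear_combination e), x, y, by ring⟩

theorem isSquare_of_odd_pow_mul (hp5 : (5 : ZMod p) ≠ 0) {h : ℤ} (hh : ¬ (p : ℤ) ∣ h) {k : ℕ}
    (hs : FormSolvable ((p : ℤ_[p]) ^ (2 * k + 1) * h)) : IsSquare (79 : ZMod p) := by
  by_contra hsq
  have hp0 : (p : ℤ_[p]) ≠ 0 := by exact_mod_cast (Fact.out : p.Prime).ne_zero
  induction k with
  | zero =>
    obtain ⟨d, hd, -⟩ := descent (c := (h : ℤ_[p])) hp5 hsq (by simpa using hs)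
    refine hh ((PadicInt.norm_int_lt_one_iff_dvd (p := p) h).1 ?_)
    exact (PadicInt.norm_lt_one_iff_dvd _).2 ⟨d, hd⟩
  | succ k ih =>
    obtain ⟨d, hd, hs⟩ := descent (c := (p : ℤ_[p]) ^ (2 * k + 2) * h) hp5 hsq
      (by convert hs using 1; ring)
    refine ih ?_
    convert hs using 1
    exact mul_left_cancel₀ hp0 (by rw [← hd]; ring)

end Padic

end FormSolvable

theorem Int.exists_eq_pow_padicValInt_mul {p : ℕ} (hp : p.Prime) {g : ℤ} (hg : g ≠ 0) :
    ∃ h : ℤ, g = p ^ padicValInt p g * h ∧ ¬ (p : ℤ) ∣ h := by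
  have := Fact.mk hp
  obtain ⟨h, hh⟩ := padicValInt_dvd (p := p) g
  refine ⟨h, hh, fun ⟨k, hk⟩ ↦ ?_⟩
  have hd : (p : ℤ) ^ (padicValInt p g + 1) ∣ g := ⟨k, by rw [pow_succ, mul_assoc, ← hk, ← hh]⟩
  have := ((padicValInt_dvd_iff _ _).1 hd).resolve_left hg
  omega

theorem padicValInt_mul_of_not_dvd {p : ℕ} [Fact p.Prime] {a b : ℤ} (ha : ¬ (p : ℤ) ∣ a)
    (hb : b ≠ 0) : padicValInt p (a * b) = padicValInt p b := by
  rw [padicValInt.mul (by rintro rfl; simp at ha) hb, padicValInt.eq_zero_of_not_dvd ha, zero_add]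

/-- If `(a/p) = 1` for every prime `p` dividing `n` to an odd power, then `(a/n) = 1`. -/
theorem jacobiSym.eq_one_of_odd_padicValNat {a : ℤ} {n : ℕ} (hn : n ≠ 0) (hc : a.gcd n = 1)
    (h : ∀ p : ℕ, ∀ hp : p.Prime, Odd (padicValNat p n) → @legendreSym p ⟨hp⟩ a = 1) :
    jacobiSym a n = 1 := by
  obtain ⟨m, b, rfl, hm⟩ := Nat.sq_mul_squarefree n
  have hm0 : m ≠ 0 := hm.ne_zero
  have hb0 : b ≠ 0 := by rintro rfl; simp at hn
  have hcb : a.gcd b = 1 := by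
    rw [Int.gcd_eq_natAbs_gcd_natAbs, Int.natAbs_natCast] at hc ⊢
    exact Nat.Coprime.coprime_dvd_right ((dvd_pow_self b two_ne_zero).mul_right m) hc
  rw [jacobiSym.mul_right' a (pow_ne_zero 2 hb0) hm0, jacobiSym.pow_right, jacobiSym.sq_one hcb,
    one_mul, jacobiSym]
  refine List.prod_eq_one fun x hx ↦ ?_
  obtain ⟨p, hp, rfl⟩ := List.mem_pmap.1 hx
  have hpp := Nat.prime_of_mem_primeFactorsList hp
  have := Fact.mk hpp
  refine h p hpp ?_
  have hv : padicValNat p m = 1 := by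
    rw [← Nat.factorization_def m hpp]
    exact Nat.factorization_eq_one_of_squarefree hm hpp (Nat.dvd_of_mem_primeFactorsList hp)
  rw [padicValNat.mul (pow_ne_zero 2 hb0) hm0, padicValNat.pow, hv]
  exact odd_two_mul_add_one _

theorem emod_four_eq_three_of_jacobiSym {k : ℤ} (hodd : Odd k)
    (h1 : jacobiSym k 79 = -1) (h2 : jacobiSym 79 k.natAbs = 1) : k % 4 = 3 := by
  have hn : Odd k.natAbs := Int.natAbs_odd.2 hodd
  have hneg := jacobiSym.neg k (b := 79) (by decide)
  rw [h1, show ZMod.χ₄ (79 : ℕ) = -1 by decide] at hneg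
  rcases Nat.odd_mod_four_iff.1 (Nat.odd_iff.1 hn) with h4 | h4
  · have hr := jacobiSym.quadratic_reciprocity_one_mod_four h4 (b := 79) (by decide)
    push_cast at hr
    rw [h2] at hr
    rcases le_total 0 k with hk | hk
    · rw [abs_of_nonneg hk, h1] at hr
      norm_num at hr
    · omega
  · have hr := jacobiSym.quadratic_reciprocity_three_mod_four h4 (b := 79) (by decide)
    push_cast at hr
    rw [h2] at hr
    rcases le_total 0 k with hk | hk
    · omega
    · rw [abs_of_nonpos hk, hneg] at hr
      norm_num at hr

theorem emod_four_eq_three_of_legendreSym [Fact (Nat.Prime 79)] {m h : ℤ} {a s : ℕ}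
    (hm : ¬ (2 : ℤ) ∣ m) (hh : ¬ (79 : ℤ) ∣ h) (hmh : 2 ^ a * m = (-79) ^ s * h)
    (h1 : legendreSym 79 h = -1)
    (h2 : ∀ p : ℕ, ∀ hp : p.Prime, p ≠ 2 → p ≠ 5 → p ≠ 79 →
      Odd (padicValInt p (2 ^ a * m)) → @legendreSym p ⟨hp⟩ 79 = 1) : m % 4 = 3 := by
  obtain ⟨k, rfl⟩ : (-79) ^ s ∣ m :=
    IsCoprime.dvd_of_dvd_mul_left (IsCoprime.pow (by norm_num)) ⟨h, hmh⟩
  have hk : h = 2 ^ a * k :=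
    mul_left_cancel₀ (pow_ne_zero s (by norm_num : (-79 : ℤ) ≠ 0)) (by rw [← hmh]; ring)
  have hk2 : Odd k := by
    rw [← Int.not_even_iff_odd, even_iff_two_dvd]
    exact fun hd ↦ hm (hd.mul_left _)
  have hk79 : ¬ (79 : ℤ) ∣ k := fun hd ↦ hh (hk ▸ hd.mul_left _)
  have hk0 : k ≠ 0 := by rintro rfl; simp at hk79
  have hk1 : jacobiSym k 79 = -1 := by
    rwa [hk, jacobiSym.legendreSym.to_jacobiSym, jacobiSym.mul_left, jacobiSym.pow_left,
      show jacobiSym 2 79 = 1 by norm_num, one_pow, one_mul] at h1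
  have hmod : (-79) ^ s * k % 4 = k % 4 := by
    have : (-79 : ℤ) ^ s ≡ 1 ^ s [ZMOD 4] := Int.ModEq.pow s (by decide)
    simpa [Int.ModEq] using this.mul_right k
  rw [hmod]
  refine emod_four_eq_three_of_jacobiSym hk2 hk1
    (jacobiSym.eq_one_of_odd_padicValNat (Int.natAbs_ne_zero.2 hk0) ?_ fun p hp hodd ↦ ?_)
  · rw [Int.gcd_eq_natAbs_gcd_natAbs, Int.natAbs_natCast]
    exact (Nat.Prime.coprime_iff_not_dvd (p := 79) Fact.out).2
      fun hd ↦ hk79 (Int.natCast_dvd.2 hd)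
  · have := Fact.mk hp
    have hpk : (p : ℤ) ∣ k := by
      by_contra hd
      have := padicValInt.eq_zero_of_not_dvd hd
      rw [padicValInt] at this
      simp [this] at hodd
    have hp2 : p ≠ 2 := by
      rintro rfl
      exact hm (Dvd.dvd.mul_left (by exact_mod_cast hpk) _)
    have hp79 : p ≠ 79 := by
      rintro rfl
      exact hk79 (by exact_mod_cast hpk)
    by_cases hp5 : p = 5
    · subst hp5
      norm_num
    refine h2 p hp hp2 hp5 hp79 ?_
    have hpp := Nat.prime_iff_prime_int.1 hp
    have hd2 : ¬ (p : ℤ) ∣ 2 ^ a := fun hd ↦ hp2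
      ((Nat.prime_dvd_prime_iff_eq hp Nat.prime_two).1 (by exact_mod_cast hpp.dvd_of_dvd_pow hd))
    have hd79 : ¬ (p : ℤ) ∣ (-79) ^ s := fun hd ↦ hp79
      ((Nat.prime_dvd_prime_iff_eq hp Fact.out).1
        (by exact_mod_cast (Int.dvd_neg.1 (hpp.dvd_of_dvd_pow hd))))
    rwa [padicValInt_mul_of_not_dvd hd2 (mul_ne_zero (pow_ne_zero _ (by norm_num)) hk0),
      padicValInt_mul_of_not_dvd hd79 hk0]

/-- Local solvability criterion for `5x² + 14xy - 6y² + g = 0` with `g ≠ 0`: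
it is solvable in `ℤ_p` for every prime `p` iff the two listed conditions hold. -/
theorem locally_solvable_5_14_neg6_iff (g : ℤ) (hg : g ≠ 0)
    (s2 : ℕ) (hs2 : s2 = padicValInt 79 g) :
    (∀ (p : ℕ) (hp : p.Prime),
      letI : Fact p.Prime := ⟨hp⟩
      ∃ x y : ℤ_[p], 5 * x ^ 2 + 14 * x * y - 6 * y ^ 2 + (g : ℤ_[p]) = 0) ↔
      @legendreSym 79 ⟨by norm_num⟩ ((-1) ^ s2 * g / 79 ^ s2) = -1 ∧
      (∀ p : ℕ, ∀ hp : p.Prime, p ≠ 2 → p ≠ 5 → p ≠ 79 →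
        Odd (padicValInt p g) → @legendreSym p ⟨hp⟩ 79 = 1) := by
  have : Fact (Nat.Prime 79) := ⟨by norm_num⟩
  have : Fact (Nat.Prime 5) := ⟨by norm_num⟩
  have natCast_ne {p q : ℕ} (hp : p.Prime) (hq : q.Prime) (h : p ≠ q) : (q : ZMod p) ≠ 0 :=
    fun h0 ↦ h ((Nat.prime_dvd_prime_iff_eq hp hq).1 ((ZMod.natCast_eq_zero_iff q p).1 h0))
  obtain ⟨h, hh, hd⟩ : ∃ h : ℤ, g = (-79) ^ s2 * h ∧ ¬ (79 : ℤ) ∣ h := by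
    obtain ⟨h, hh, hd⟩ := Int.exists_eq_pow_padicValInt_mul (p := 79) Fact.out hg
    refine ⟨(-1) ^ s2 * h, ?_, fun hdvd ↦ hd ?_⟩
    · rw [← mul_assoc, ← mul_pow, hs2]
      exact hh
    · rcases neg_one_pow_eq_or ℤ s2 with e | e <;> simpa [e] using hdvd
  have hquot : (-1) ^ s2 * g / 79 ^ s2 = h := by
    rw [hh, ← mul_assoc, ← mul_pow]
    exact Int.mul_ediv_cancel_left _ (by positivity)
  have h79 : FormSolvable (g : ℤ_[79]) ↔ legendreSym 79 h = -1 := by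
    rw [← FormSolvable.at_79_iff hd, hh]
    simpa using FormSolvable.neg_79_pow_mul_iff (c := (h : ℤ_[79])) s2
  rw [hquot, ← h79]
  constructor
  · intro hs
    refine ⟨hs 79 Fact.out, fun p hp hp2 hp5 hp79 hodd ↦ ?_⟩
    have := Fact.mk hp
    have h79p : ((79 : ℤ) : ZMod p) ≠ 0 := by
      exact_mod_cast natCast_ne hp (Fact.out : Nat.Prime 79) hp79
    rw [legendreSym.eq_one_iff p h79p]
    obtain ⟨h, hh, hd⟩ := Int.exists_eq_pow_padicValInt_mul hp hg
    obtain ⟨k, hk⟩ := hodd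
    have hsol : FormSolvable (g : ℤ_[p]) := hs p hp
    rw [hh, hk] at hsol
    push_cast at hsol
    exact_mod_cast FormSolvable.isSquare_of_odd_pow_mul
      (by exact_mod_cast natCast_ne hp Nat.prime_five hp5) hd hsol
  · rintro ⟨hs79, hleg⟩ p hp
    have := Fact.mk hp
    change FormSolvable (g : ℤ_[p])
    by_cases hp2 : p = 2
    · subst hp2
      obtain ⟨m, hm, hdm⟩ := Int.exists_eq_pow_padicValInt_mul Nat.prime_two hg
      generalize padicValInt 2 g = a at hm
      subst hm
      have hm4 := emod_four_eq_three_of_legendreSym (by exact_mod_cast hdm) hd hh (h79.1 hs79) hleg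
      simpa using (FormSolvable.at_two hm4).two_pow_mul a
    by_cases hp5 : p = 5
    · subst hp5
      exact FormSolvable.at_five g
    by_cases hp79 : p = 79
    · subst hp79
      exact hs79
    have h5p : (5 : ZMod p) ≠ 0 := by exact_mod_cast natCast_ne hp Nat.prime_five hp5
    have h79p : (79 : ZMod p) ≠ 0 := by
      exact_mod_cast natCast_ne hp (Fact.out : Nat.Prime 79) hp79
    obtain ⟨m, hm, hdm⟩ := Int.exists_eq_pow_padicValInt_mul hp hg
    rcases Nat.even_or_odd (padicValInt p g) with ⟨k, hk⟩ | hodd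
    · rw [hm, hk, ← two_mul, mul_comm 2 k, pow_mul]
      simpa using (FormSolvable.of_not_dvd hp2 h5p h79p hdm).sq_mul ((p : ℤ_[p]) ^ k)
    · have hsq := (legendreSym.eq_one_iff p (by exact_mod_cast h79p)).1
        (hleg p hp hp2 hp5 hp79 hodd)
      refine FormSolvable.of_isSquare hp2 h5p h79p (by exact_mod_cast hsq) ?_
      rw [hm]
      exact (dvd_pow_self _ hodd.pos.ne').mul_right m
end

section
/- The ideal class group of the imaginary quadratic field ℚ(√-14) is cyclic of order 4; in particular, the class number of ℚ(√-14) equals 4. -/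
open NumberField Module

section SqrtNegFourteen

theorem exists_ringOfIntegers_sqrt {K : Type*} [Field K] {α : K} (hα : α ^ 2 = -14) :
    ∃ ω : 𝓞 K, (ω : K) = α :=
  ⟨⟨α, IsIntegral.of_pow two_pos (by
    rw [hα]; simpa using isIntegral_algebraMap (R := ℤ) (A := K) (x := -14))⟩, rfl⟩

theorem ringOfIntegers_sq {K : Type*} [Field K] {ω : 𝓞 K} (hα : (ω : K) ^ 2 = -14) :
    ω ^ 2 = -14 :=
  RingOfIntegers.ext (by push_cast; simpa using! hα)

section Ideals

variable {R : Type*} [CommRing R] {ω : R}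

theorem span_two_sq (hω : ω ^ 2 = -14) :
    Ideal.span {2, ω} * Ideal.span {2, ω} = Ideal.span {2} := by
  apply le_antisymm
  · rw [Ideal.span_pair_mul_span_pair]
    simp only [Ideal.span_le, Set.insert_subset_iff, Set.singleton_subset_iff, SetLike.mem_coe,
      Ideal.mem_span_singleton]
    exact ⟨⟨2, rfl⟩, ⟨ω, rfl⟩, ⟨ω, mul_comm _ _⟩, ⟨-7, by linear_combination hω⟩⟩
  · rw [Ideal.span_singleton_le_iff_mem]
    have h2 : (2 : R) ∈ Ideal.span {2, ω} := Ideal.subset_span (Set.mem_insert _ _)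
    have hw : ω ∈ Ideal.span {2, ω} := Ideal.subset_span (Set.mem_insert_of_mem _ rfl)
    convert add_mem (Ideal.mul_mem_left _ 4 (Ideal.mul_mem_mul h2 h2)) (Ideal.mul_mem_mul hw hw)
      using 1
    linear_combination -hω

theorem span_three_mul_span_three (hω : ω ^ 2 = -14) :
    Ideal.span {3, ω - 1} * Ideal.span {3, ω + 1} = Ideal.span {3} := by
  apply le_antisymm
  · rw [Ideal.span_pair_mul_span_pair]
    simp only [Ideal.span_le, Set.insert_subset_iff, Set.singleton_subset_iff, SetLike.mem_coe,
      Ideal.mem_span_singleton]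
    exact ⟨⟨3, rfl⟩, ⟨_, rfl⟩, ⟨_, mul_comm _ _⟩, ⟨-5, by linear_combination hω⟩⟩
  · rw [Ideal.span_singleton_le_iff_mem]
    have h3 : (3 : R) ∈ Ideal.span {3, ω - 1} := Ideal.subset_span (Set.mem_insert _ _)
    have h3' : (3 : R) ∈ Ideal.span {3, ω + 1} := Ideal.subset_span (Set.mem_insert _ _)
    have hw : ω - 1 ∈ Ideal.span {3, ω - 1} := Ideal.subset_span (Set.mem_insert_of_mem _ rfl)
    have hw' : ω + 1 ∈ Ideal.span {3, ω + 1} := Ideal.subset_span (Set.mem_insert_of_mem _ rfl)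
    convert add_mem (Ideal.mul_mem_left _ 2 (Ideal.mul_mem_mul h3 h3')) (Ideal.mul_mem_mul hw hw')
      using 1
    linear_combination -hω

theorem span_three_sq (hω : ω ^ 2 = -14) :
    Ideal.span {3, ω - 1} * Ideal.span {3, ω - 1} = Ideal.span {9, ω + 2} := by
  apply le_antisymm
  · rw [Ideal.span_pair_mul_span_pair]
    simp only [Ideal.span_le, Set.insert_subset_iff, Set.singleton_subset_iff, SetLike.mem_coe,
      Ideal.mem_span_pair]
    exact ⟨⟨1, 0, by ring⟩, ⟨-1, 3, by ring⟩, ⟨-1, 3, by ring⟩,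
      ⟨-1, -2, by linear_combination -hω⟩⟩
  · simp only [Ideal.span_le, Set.insert_subset_iff, Set.singleton_subset_iff, SetLike.mem_coe]
    have h3 : (3 : R) ∈ Ideal.span {3, ω - 1} := Ideal.subset_span (Set.mem_insert _ _)
    have hw : ω - 1 ∈ Ideal.span {3, ω - 1} := Ideal.subset_span (Set.mem_insert_of_mem _ rfl)
    have h9 := Ideal.mul_mem_mul h3 h3
    refine ⟨by norm_num at h9; exact h9, ?_⟩
    convert add_mem (add_mem (Ideal.mul_mem_mul hw hw) (Ideal.mul_mem_mul h3 hw))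
      (Ideal.mul_mem_left _ 2 h9) using 1
    linear_combination -hω

theorem span_two_mul_span_three_sq (hω : ω ^ 2 = -14) :
    Ideal.span {2, ω} * (Ideal.span {3, ω - 1} * Ideal.span {3, ω - 1}) =
      Ideal.span {ω + 2} := by
  rw [span_three_sq hω]
  apply le_antisymm
  · rw [Ideal.span_pair_mul_span_pair]
    simp only [Ideal.span_le, Set.insert_subset_iff, Set.singleton_subset_iff, SetLike.mem_coe,
      Ideal.mem_span_singleton]
    exact ⟨⟨2 - ω, by linear_combination hω⟩, ⟨2, by ring⟩, ⟨7 + ω, by linear_combination -hω⟩,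
      ⟨ω, by ring⟩⟩
  · rw [Ideal.span_singleton_le_iff_mem]
    have h2 : (2 : R) ∈ Ideal.span {2, ω} := Ideal.subset_span (Set.mem_insert _ _)
    have hw : ω ∈ Ideal.span {2, ω} := Ideal.subset_span (Set.mem_insert_of_mem _ rfl)
    have h9 : (9 : R) ∈ Ideal.span {9, ω + 2} := Ideal.subset_span (Set.mem_insert _ _)
    have hw' : ω + 2 ∈ Ideal.span {9, ω + 2} := Ideal.subset_span (Set.mem_insert_of_mem _ rfl)
    convert sub_mem (add_mem (Ideal.mul_mem_mul hw h9) (Ideal.mul_mem_mul h2 h9))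
      (Ideal.mul_mem_left _ 4 (Ideal.mul_mem_mul h2 hw')) using 1
    ring

end Ideals

variable {K : Type*} [Field K] [NumberField K] {α : K}

theorem exists_rat_add_mul_sqrt (hα : α ^ 2 = -14) (hK : Algebra.adjoin ℚ {α} = ⊤) (x : K) :
    ∃ p q : ℚ, x = p + q * α := by
  have hx : x ∈ Algebra.adjoin ℚ {α} := hK ▸ Algebra.mem_top
  induction hx using Algebra.adjoin_induction with
  | mem x hx => exact ⟨0, 1, by simpa using hx⟩
  | algebraMap r => exact ⟨r, 0, by simp⟩
  | add x y _ _ hx hy =>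
    obtain ⟨p, q, rfl⟩ := hx
    obtain ⟨r, s, rfl⟩ := hy
    exact ⟨p + r, q + s, by push_cast; ring⟩
  | mul x y _ _ hx hy =>
    obtain ⟨p, q, rfl⟩ := hx
    obtain ⟨r, s, rfl⟩ := hy
    refine ⟨p * r - 14 * q * s, p * s + q * r, ?_⟩
    push_cast
    linear_combination (q * s : K) * hα

theorem rat_add_mul_sqrt_eq_zero (hα : α ^ 2 = -14) {p q : ℚ} (h : (p : K) + q * α = 0) :
    p = 0 ∧ q = 0 := by
  have h2 : ((p ^ 2 + 14 * q ^ 2 : ℚ) : K) = 0 := by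
    push_cast
    linear_combination (p - q * α : K) * h + (q : K) ^ 2 * hα
  have h3 : p ^ 2 + 14 * q ^ 2 = 0 := by exact_mod_cast h2
  constructor <;> nlinarith [sq_nonneg p, sq_nonneg q]

/-- The `ℚ`-basis `1, α` of `ℚ(√-14)`. -/
noncomputable def sqrtBasis (hα : α ^ 2 = -14) (hK : Algebra.adjoin ℚ {α} = ⊤) :
    Basis (Fin 2) ℚ K :=
  Basis.mk (v := ![1, α])
    (LinearIndependent.pair_iff.mpr fun p q h ↦
      rat_add_mul_sqrt_eq_zero hα (by simpa [Algebra.smul_def] using h))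
    (by
      intro x _
      obtain ⟨p, q, rfl⟩ := exists_rat_add_mul_sqrt hα hK x
      simp only [Matrix.range_cons, Matrix.range_empty, Set.union_empty, Set.singleton_union]
      exact Submodule.mem_span_pair.mpr ⟨p, q, by simp [Algebra.smul_def]⟩)

theorem leftMulMatrix_sqrtBasis (hα : α ^ 2 = -14) (hK : Algebra.adjoin ℚ {α} = ⊤) (p q : ℚ) :
    Algebra.leftMulMatrix (sqrtBasis hα hK) (p + q * α) = !![p, -14 * q; q, p] := by
  set b := sqrtBasis hα hK with hb
  have h0 : b 0 = 1 := by simp [hb, sqrtBasis]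
  have h1 : b 1 = α := by simp [hb, sqrtBasis]
  have e0 : (p + q * α) * b 0 = p • b 0 + q • b 1 := by
    rw [h0, h1]; simp [Algebra.smul_def]
  have e1 : (p + q * α) * b 1 = (-14 * q) • b 0 + p • b 1 := by
    rw [h0, h1]; simp only [Algebra.smul_def]
    simp
    linear_combination (q : K) * hα
  ext i j
  rw [Algebra.leftMulMatrix_eq_repr_mul]
  fin_cases j
  · simp only [Fin.zero_eta, e0]
    fin_cases i <;> simp
  · simp only [Fin.mk_one, e1]
    fin_cases i <;> simp

theorem trace_rat_add_mul_sqrt (hα : α ^ 2 = -14) (hK : Algebra.adjoin ℚ {α} = ⊤) (p q : ℚ) :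
    Algebra.trace ℚ K (p + q * α) = 2 * p := by
  rw [Algebra.trace_eq_matrix_trace (sqrtBasis hα hK), leftMulMatrix_sqrtBasis,
    Matrix.trace_fin_two]
  simp [two_mul]

theorem norm_rat_add_mul_sqrt (hα : α ^ 2 = -14) (hK : Algebra.adjoin ℚ {α} = ⊤) (p q : ℚ) :
    Algebra.norm ℚ (p + q * α) = p ^ 2 + 14 * q ^ 2 := by
  rw [Algebra.norm_eq_matrix_det (sqrtBasis hα hK), leftMulMatrix_sqrtBasis,
    Matrix.det_fin_two]
  simp
  ring

theorem exists_int_of_fourteen_mul_sq {r : ℚ} {n : ℤ} (h : 14 * r ^ 2 = n) : ∃ m : ℤ, r = m := by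
  have h1 : 14 * r.num ^ 2 = (r.den : ℤ) ^ 2 * n := by
    have hd : (r.den : ℚ) ≠ 0 := by exact_mod_cast r.den_ne_zero
    rw [← Rat.num_div_den r] at h
    field_simp at h
    exact_mod_cast h
  have hco : IsCoprime ((r.den : ℤ) ^ 2) (r.num ^ 2) :=
    (Int.isCoprime_iff_gcd_eq_one.mpr (by simpa [Int.gcd] using r.reduced.symm)).pow
  have h2 : (r.den : ℤ) ^ 2 ∣ 14 := hco.dvd_of_dvd_mul_right ⟨n, h1⟩
  have h3 : r.den ^ 2 ∣ 14 := by exact_mod_cast h2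
  have h4 : r.den < 4 := by nlinarith [Nat.le_of_dvd (by norm_num) h3]
  have h5 := r.den_pos
  refine ⟨r.num, ((Rat.den_eq_one_iff r).mp ?_).symm⟩
  interval_cases r.den <;> simp_all

theorem exists_int_add_mul_sqrt (hα : α ^ 2 = -14) (hK : Algebra.adjoin ℚ {α} = ⊤)
    {x : K} (hx : IsIntegral ℤ x) : ∃ a b : ℤ, x = a + b * α := by
  obtain ⟨p, q, rfl⟩ := exists_rat_add_mul_sqrt hα hK x
  obtain ⟨t, ht⟩ := IsIntegrallyClosed.isIntegral_iff.mp (Algebra.isIntegral_trace (L := ℚ) hx)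
  obtain ⟨n, hn⟩ := IsIntegrallyClosed.isIntegral_iff.mp (Algebra.isIntegral_norm ℚ hx)
  rw [trace_rat_add_mul_sqrt hα hK] at ht
  rw [norm_rat_add_mul_sqrt hα hK] at hn
  simp only [eq_intCast] at ht hn
  obtain ⟨s, hs⟩ := exists_int_of_fourteen_mul_sq (r := 2 * q) (n := 4 * n - t ^ 2) (by
    push_cast; rw [ht, hn]; ring)
  have h : t ^ 2 + 14 * s ^ 2 = 4 * n := by
    have : (t : ℚ) ^ 2 + 14 * s ^ 2 = 4 * n := by rw [ht, hn, ← hs]; ring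
    exact_mod_cast this
  obtain ⟨a, rfl | rfl⟩ := Int.even_or_odd' t <;>
  obtain ⟨b, rfl | rfl⟩ := Int.even_or_odd' s <;> ring_nf at h <;> try omega
  push_cast at ht hs
  exact ⟨a, b, by rw [show p = a by linarith, show q = b by linarith]; simp⟩

variable {ω : 𝓞 K}

theorem ringOfIntegers_eq_int_add_mul (hα : (ω : K) ^ 2 = -14)
    (hK : Algebra.adjoin ℚ {(ω : K)} = ⊤) (x : 𝓞 K) : ∃ a b : ℤ, x = a + b * ω := by
  obtain ⟨a, b, h⟩ := exists_int_add_mul_sqrt hα hK x.isIntegral_coe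
  exact ⟨a, b, RingOfIntegers.ext (by simpa using h)⟩

theorem norm_int_add_mul (hα : (ω : K) ^ 2 = -14) (hK : Algebra.adjoin ℚ {(ω : K)} = ⊤)
    (a b : ℤ) : Algebra.norm ℤ (a + b * ω : 𝓞 K) = a ^ 2 + 14 * b ^ 2 := by
  have := Algebra.coe_norm_int (a + b * ω : 𝓞 K)
  have h := norm_rat_add_mul_sqrt hα hK a b
  simp at this h
  rw [h] at this
  exact_mod_cast this

theorem trace_int_add_mul (hα : (ω : K) ^ 2 = -14) (hK : Algebra.adjoin ℚ {(ω : K)} = ⊤)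
    (a b : ℤ) : Algebra.trace ℤ (𝓞 K) (a + b * ω : 𝓞 K) = 2 * a := by
  have := Algebra.coe_trace_int (a + b * ω : 𝓞 K)
  have h := trace_rat_add_mul_sqrt hα hK a b
  simp only [Rat.cast_intCast] at h
  simp only [map_add, map_mul, map_intCast] at this
  rw [← map_add, ← map_add, h] at this
  exact_mod_cast this

/-- The `ℤ`-basis `1, ω` of the ring of integers of `ℚ(√-14)`. -/
noncomputable def integralSqrtBasis (hα : (ω : K) ^ 2 = -14)
    (hK : Algebra.adjoin ℚ {(ω : K)} = ⊤) : Basis (Fin 2) ℤ (𝓞 K) :=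
  Basis.mk (v := ![1, ω])
    (LinearIndependent.pair_iff.mpr fun a b h ↦ by
      have := congrArg (algebraMap (𝓞 K) K) h
      simpa using rat_add_mul_sqrt_eq_zero hα (p := a) (q := b) (by simpa using this))
    (by
      intro x _
      obtain ⟨a, b, rfl⟩ := ringOfIntegers_eq_int_add_mul hα hK x
      simp only [Matrix.range_cons, Matrix.range_empty, Set.union_empty, Set.singleton_union]
      exact Submodule.mem_span_pair.mpr ⟨a, b, by simp⟩)

theorem discr_sqrt_neg14 (hα : (ω : K) ^ 2 = -14) (hK : Algebra.adjoin ℚ {(ω : K)} = ⊤) :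
    discr K = -56 := by
  have h1 := trace_int_add_mul hα hK 1 0
  have hω := trace_int_add_mul hα hK 0 1
  have hs := trace_int_add_mul hα hK (-14) 0
  simp at h1 hω hs
  rw [← discr_eq_discr K (integralSqrtBasis hα hK), Algebra.discr_def, Matrix.det_fin_two]
  simp [Algebra.traceMatrix_apply, integralSqrtBasis, ← pow_two, ringOfIntegers_sq hα, h1, hω, hs]

theorem exists_mk0_eq_absNorm_le_four (hα : (ω : K) ^ 2 = -14)
    (hK : Algebra.adjoin ℚ {(ω : K)} = ⊤) (C : ClassGroup (𝓞 K)) :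
    ∃ I : nonZeroDivisors (Ideal (𝓞 K)), ClassGroup.mk0 I = C ∧
      Ideal.absNorm (I : Ideal (𝓞 K)) ≤ 4 := by
  obtain ⟨I, hI, h⟩ := exists_ideal_in_class_of_norm_le C
  refine ⟨I, hI, ?_⟩
  have hfin : finrank ℚ K = 2 := by simpa using finrank_eq_card_basis (sqrtBasis hα hK)
  have hr : InfinitePlace.nrComplexPlaces K ≤ 1 := by
    have := InfinitePlace.card_add_two_mul_card_eq_rank K
    omega
  rw [hfin, discr_sqrt_neg14 hα hK] at h
  have hπ := Real.pi_gt_d2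
  have h4 : (4 / Real.pi) ^ InfinitePlace.nrComplexPlaces K ≤ 1.2739 := by
    calc (4 / Real.pi) ^ InfinitePlace.nrComplexPlaces K ≤ (4 / Real.pi) ^ 1 := by
          apply pow_le_pow_right₀ _ hr
          rw [one_le_div Real.pi_pos]; exact Real.pi_le_four
      _ ≤ 1.2739 := by
          rw [pow_one, div_le_iff₀ Real.pi_pos]; linarith
  have hsqrt : √(56 : ℝ) ≤ 7.5 := Real.sqrt_le_iff.mpr (by norm_num)
  norm_num [Nat.factorial] at h
  have h5 : (Ideal.absNorm (I : Ideal (𝓞 K)) : ℝ) < 5 := by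
    refine h.trans_lt ?_
    calc _ ≤ (1.2739 : ℝ) * (1 / 2 * 7.5) := by gcongr
      _ < 5 := by norm_num
  exact Nat.lt_succ_iff.mp (by exact_mod_cast h5)

theorem absNorm_span_int_add_mul (hα : (ω : K) ^ 2 = -14)
    (hK : Algebra.adjoin ℚ {(ω : K)} = ⊤) (a b : ℤ) :
    (Ideal.absNorm (Ideal.span {(a + b * ω : 𝓞 K)}) : ℤ) = a ^ 2 + 14 * b ^ 2 := by
  rw [Ideal.absNorm_span_singleton, norm_int_add_mul hα hK, Int.natCast_natAbs]
  exact abs_of_nonneg (by positivity)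

theorem absNorm_span_two (hα : (ω : K) ^ 2 = -14) (hK : Algebra.adjoin ℚ {(ω : K)} = ⊤) :
    Ideal.absNorm (Ideal.span {2, ω}) = 2 := by
  have h := absNorm_span_int_add_mul hα hK 2 0
  have hm := congrArg Ideal.absNorm (span_two_sq (ringOfIntegers_sq hα))
  rw [map_mul] at hm
  rw [show ((2 : ℤ) + (0 : ℤ) * ω : 𝓞 K) = 2 by simp, ← hm] at h
  push_cast at h
  nlinarith

theorem absNorm_span_three (hα : (ω : K) ^ 2 = -14) (hK : Algebra.adjoin ℚ {(ω : K)} = ⊤) :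
    Ideal.absNorm (Ideal.span {3, ω - 1}) = 3 := by
  have h := absNorm_span_int_add_mul hα hK 2 1
  have hm := congrArg Ideal.absNorm (span_two_mul_span_three_sq (ringOfIntegers_sq hα))
  rw [map_mul, map_mul, absNorm_span_two hα hK] at hm
  rw [show ((2 : ℤ) + (1 : ℤ) * ω : 𝓞 K) = ω + 2 by simp [add_comm], ← hm] at h
  push_cast at h
  nlinarith

theorem absNorm_span_three_conj (hα : (ω : K) ^ 2 = -14)
    (hK : Algebra.adjoin ℚ {(ω : K)} = ⊤) :
    Ideal.absNorm (Ideal.span {3, ω + 1}) = 3 := by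
  have h := absNorm_span_int_add_mul hα hK 3 0
  have hm := congrArg Ideal.absNorm (span_three_mul_span_three (ringOfIntegers_sq hα))
  rw [map_mul, absNorm_span_three hα hK] at hm
  rw [show ((3 : ℤ) + (0 : ℤ) * ω : 𝓞 K) = 3 by simp, ← hm] at h
  push_cast at h
  omega

theorem eq_of_le_of_prime_absNorm {P Q : Ideal (𝓞 K)} (hP : P.IsPrime)
    (hQ : (Ideal.absNorm Q).Prime) (h : Q ≤ P) : P = Q := by
  have hQ0 : Q ≠ ⊥ := by
    rintro rfl
    simp at hQ
    exact Nat.not_prime_zero hQ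
  have := Ideal.isPrime_of_irreducible_absNorm hQ
  exact ((this.isMaximal hQ0).eq_of_le hP.ne_top h).symm

theorem prime_eq_of_absNorm_le_four (hα : (ω : K) ^ 2 = -14)
    (hK : Algebra.adjoin ℚ {(ω : K)} = ⊤) {P : Ideal (𝓞 K)} (hP : P.IsPrime)
    (h0 : Ideal.absNorm P ≠ 0) (h4 : Ideal.absNorm P ≤ 4) :
    P = Ideal.span {2, ω} ∨ P = Ideal.span {3, ω - 1} ∨ P = Ideal.span {3, ω + 1} := by
  have hω := ringOfIntegers_sq hα
  have hmem := Ideal.absNorm_mem P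
  have h1 : Ideal.absNorm P ≠ 1 := fun h ↦ hP.ne_top (Ideal.absNorm_eq_one_iff.mp h)
  have h23 : (2 : 𝓞 K) ∈ P ∨ (3 : 𝓞 K) ∈ P := by
    generalize Ideal.absNorm P = n at *
    interval_cases n
    · exact absurd rfl h0
    · exact absurd rfl h1
    · exact Or.inl (by simpa using hmem)
    · exact Or.inr (by simpa using hmem)
    · rw [show ((4 : ℕ) : 𝓞 K) = 2 * 2 by norm_num] at hmem
      exact Or.inl ((hP.mem_or_mem hmem).elim id id)
  rcases h23 with h | h
  · left
    apply eq_of_le_of_prime_absNorm hP (by rw [absNorm_span_two hα hK]; norm_num)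
    have hw : ω ∈ P := hP.mem_of_pow_mem 2 (by
      rw [hω, show (-14 : 𝓞 K) = -7 * 2 by norm_num]
      exact P.mul_mem_left _ h)
    simpa [Ideal.span_le, Set.insert_subset_iff] using ⟨h, hw⟩
  · right
    have hw : (ω - 1) * (ω + 1) ∈ P := by
      rw [show (ω - 1) * (ω + 1) = -5 * 3 by linear_combination hω]
      exact P.mul_mem_left _ h
    refine (hP.mem_or_mem hw).imp (fun hw ↦ ?_) (fun hw ↦ ?_)
    · apply eq_of_le_of_prime_absNorm hP (by rw [absNorm_span_three hα hK]; norm_num)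
      simpa [Ideal.span_le, Set.insert_subset_iff] using ⟨h, hw⟩
    · apply eq_of_le_of_prime_absNorm hP (by rw [absNorm_span_three_conj hα hK]; norm_num)
      simpa [Ideal.span_le, Set.insert_subset_iff] using ⟨h, hw⟩

theorem not_isPrincipal_span_two (hα : (ω : K) ^ 2 = -14)
    (hK : Algebra.adjoin ℚ {(ω : K)} = ⊤) :
    ¬ (Ideal.span {2, ω}).IsPrincipal := by
  rintro ⟨x, hx⟩
  obtain ⟨a, b, rfl⟩ := ringOfIntegers_eq_int_add_mul hα hK x
  have h := absNorm_span_int_add_mul hα hK a b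
  rw [← Ideal.submodule_span_eq, ← hx, absNorm_span_two hα hK] at h
  push_cast at h
  have hb : b = 0 := by
    by_contra hb
    have := sq_pos_of_ne_zero hb
    nlinarith [sq_nonneg a]
  subst hb
  have ha : a ≤ 1 := by nlinarith
  have ha' : -1 ≤ a := by nlinarith
  interval_cases a <;> omega

theorem mk0_mem_of_forall_prime_dvd {H : Subgroup (ClassGroup (𝓞 K))}
    (I : nonZeroDivisors (Ideal (𝓞 K)))
    (h : ∀ P : nonZeroDivisors (Ideal (𝓞 K)), (P : Ideal (𝓞 K)).IsPrime →
      (P : Ideal (𝓞 K)) ∣ I → ClassGroup.mk0 P ∈ H) : ClassGroup.mk0 I ∈ H := by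
  obtain ⟨I, hI⟩ := I
  induction I using UniqueFactorizationMonoid.induction_on_prime with
  | h₁ => simp at hI
  | h₂ I hu =>
    have : (⟨I, hI⟩ : nonZeroDivisors (Ideal (𝓞 K))) = 1 := Subtype.ext (by simpa using hu)
    rw [this, map_one]
    exact one_mem H
  | h₃ I P hI0 hP ih =>
    have hI' := mem_nonZeroDivisors_of_ne_zero hI0
    have hP' := mem_nonZeroDivisors_of_ne_zero hP.ne_zero
    have : (⟨P * I, hI⟩ : nonZeroDivisors (Ideal (𝓞 K))) = ⟨P, hP'⟩ * ⟨I, hI'⟩ := rfl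
    rw [this, map_mul]
    exact mul_mem (h _ (Ideal.isPrime_of_prime hP) (dvd_mul_right _ _))
      (ih hI' fun Q hQ hd ↦ h Q hQ (hd.mul_left _))

/-- The class of `(3, √-14 - 1)` has order `4` and generates the class group of `ℚ(√-14)`. -/
theorem exists_generator_orderOf_eq_four (hα : (ω : K) ^ 2 = -14)
    (hK : Algebra.adjoin ℚ {(ω : K)} = ⊤) :
    ∃ g : ClassGroup (𝓞 K), orderOf g = 4 ∧ ∀ C, C ∈ Subgroup.zpowers g := by
  have hω := ringOfIntegers_sq hα
  have mem {I : Ideal (𝓞 K)} (h : Ideal.absNorm I ≠ 0) : I ∈ nonZeroDivisors (Ideal (𝓞 K)) :=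
    mem_nonZeroDivisors_of_ne_zero (by rintro rfl; simp at h)
  let p : nonZeroDivisors (Ideal (𝓞 K)) :=
    ⟨Ideal.span {2, ω}, mem (by simp [absNorm_span_two hα hK])⟩
  let q : nonZeroDivisors (Ideal (𝓞 K)) :=
    ⟨Ideal.span {3, ω - 1}, mem (by simp [absNorm_span_three hα hK])⟩
  let q' : nonZeroDivisors (Ideal (𝓞 K)) :=
    ⟨Ideal.span {3, ω + 1}, mem (by simp [absNorm_span_three_conj hα hK])⟩
  have hp : ClassGroup.mk0 p ≠ 1 := fun h ↦
    not_isPrincipal_span_two hα hK (ClassGroup.mk0_eq_one_iff p.2 |>.mp h)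
  have hpp : ClassGroup.mk0 p * ClassGroup.mk0 p = 1 := by
    rw [← map_mul]
    exact (ClassGroup.mk0_eq_one_iff (p * p).2).mpr ⟨_, span_two_sq hω⟩
  have hqq' : ClassGroup.mk0 q * ClassGroup.mk0 q' = 1 := by
    rw [← map_mul]
    exact (ClassGroup.mk0_eq_one_iff (q * q').2).mpr ⟨_, span_three_mul_span_three hω⟩
  have hpqq : ClassGroup.mk0 p * (ClassGroup.mk0 q * ClassGroup.mk0 q) = 1 := by
    rw [← map_mul, ← map_mul]
    exact (ClassGroup.mk0_eq_one_iff (p * (q * q)).2).mpr ⟨_, span_two_mul_span_three_sq hω⟩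
  have hqp : ClassGroup.mk0 q ^ 2 = ClassGroup.mk0 p := by
    rw [pow_two]
    exact mul_left_cancel (hpqq.trans hpp.symm)
  refine ⟨ClassGroup.mk0 q, ?_, fun C ↦ ?_⟩
  · refine orderOf_eq_prime_pow (p := 2) (n := 1) (by simpa [hqp] using hp) ?_
    rw [show 2 ^ (1 + 1) = 2 * 2 from rfl, pow_mul, hqp, pow_two, hpp]
  · obtain ⟨I, rfl, hI⟩ := exists_mk0_eq_absNorm_le_four hα hK C
    refine mk0_mem_of_forall_prime_dvd I fun P hP hPI ↦ ?_
    have h4 : Ideal.absNorm (P : Ideal (𝓞 K)) ≤ 4 :=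
      (Nat.le_of_dvd (Ideal.absNorm_pos_of_nonZeroDivisors I) (map_dvd _ hPI)).trans hI
    rcases prime_eq_of_absNorm_le_four hα hK hP (Ideal.absNorm_ne_zero_of_nonZeroDivisors P) h4
      with h | h | h
    · rw [show P = p from Subtype.ext h, ← hqp]
      exact pow_mem (Subgroup.mem_zpowers _) 2
    · rw [show P = q from Subtype.ext h]
      exact Subgroup.mem_zpowers _
    · rw [show P = q' from Subtype.ext h, ← inv_eq_of_mul_eq_one_right hqq']
      exact inv_mem (Subgroup.mem_zpowers _)

end SqrtNegFourteen

open NumberField in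
/-- The ideal class group of `ℚ(√-14)` is cyclic of order `4`; in particular
the class number of `ℚ(√-14)` is `4`. -/
theorem classGroup_sqrt_neg14 (K : Type*) [Field K] [NumberField K]
    (α : K) (hα : α ^ 2 = -14) (hK : Algebra.adjoin ℚ {α} = ⊤) :
    IsCyclic (ClassGroup (𝓞 K)) ∧ Nat.card (ClassGroup (𝓞 K)) = 4 ∧
      classNumber K = 4 := by
  obtain ⟨ω, rfl⟩ := exists_ringOfIntegers_sqrt hα
  obtain ⟨g, hg, hgen⟩ := exists_generator_orderOf_eq_four hα hK
  have hcard : Nat.card (ClassGroup (𝓞 K)) = 4 := by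
    rw [← hg, orderOf_eq_card_of_forall_mem_zpowers hgen]
  exact ⟨⟨g, hgen⟩, hcard, by rw [classNumber, ← Nat.card_eq_fintype_card, hcard]⟩
end

section
/- The class number of the real quadratic field ℚ(√79) equals 3. -/
open NumberField Module

section QuadraticBasis

variable {A S : Type*} [CommRing A] [CommRing S] [Algebra A S]

/-- Multiplication by `x + y θ` in the basis `1, θ`, where `θ ^ 2 = d`. -/
theorem leftMulMatrix_of_sq_eq (b : Basis (Fin 2) A S) {θ : S} {d : A} (h0 : b 0 = 1)
    (h1 : b 1 = θ) (hθ : θ ^ 2 = algebraMap A S d) (x y : A) :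
    Algebra.leftMulMatrix b (algebraMap A S x + algebraMap A S y * θ) = !![x, d * y; y, x] := by
  have e0 : (algebraMap A S x + algebraMap A S y * θ) * b 0 = x • b 0 + y • b 1 := by
    simp [h0, h1, Algebra.smul_def]
  have e1 : (algebraMap A S x + algebraMap A S y * θ) * b 1 = (d * y) • b 0 + x • b 1 := by
    simp only [h0, h1, Algebra.smul_def, map_mul]
    linear_combination algebraMap A S y * hθ
  ext i j
  rw [Algebra.leftMulMatrix_eq_repr_mul]
  fin_cases j
  · simp only [Fin.zero_eta, e0]
    fin_cases i <;> simp
  · simp only [Fin.mk_one, e1]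
    fin_cases i <;> simp

theorem trace_of_sq_eq (b : Basis (Fin 2) A S) {θ : S} {d : A} (h0 : b 0 = 1)
    (h1 : b 1 = θ) (hθ : θ ^ 2 = algebraMap A S d) (x y : A) :
    Algebra.trace A S (algebraMap A S x + algebraMap A S y * θ) = 2 * x := by
  rw [Algebra.trace_eq_matrix_trace b, leftMulMatrix_of_sq_eq b h0 h1 hθ, Matrix.trace_fin_two_of,
    two_mul]

theorem norm_of_sq_eq (b : Basis (Fin 2) A S) {θ : S} {d : A} (h0 : b 0 = 1)
    (h1 : b 1 = θ) (hθ : θ ^ 2 = algebraMap A S d) (x y : A) :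
    Algebra.norm A (algebraMap A S x + algebraMap A S y * θ) = x ^ 2 - d * y ^ 2 := by
  rw [Algebra.norm_eq_matrix_det b, leftMulMatrix_of_sq_eq b h0 h1 hθ, Matrix.det_fin_two_of]
  ring

theorem discr_of_sq_eq (b : Basis (Fin 2) A S) {θ : S} {d : A} (h0 : b 0 = 1)
    (h1 : b 1 = θ) (hθ : θ ^ 2 = algebraMap A S d) : Algebra.discr A b = 4 * d := by
  have t := trace_of_sq_eq b h0 h1 hθ
  have t0 : Algebra.trace A S 1 = 2 := by simpa using t 1 0
  have t1 : Algebra.trace A S θ = 0 := by simpa using t 0 1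
  have t2 : Algebra.trace A S (θ * θ) = 2 * d := by
    rw [← sq, hθ]
    simpa using t d 0
  rw [Algebra.discr_def, Matrix.det_fin_two]
  simp only [Algebra.traceMatrix_apply, Algebra.traceForm_apply, h0, h1, one_mul, mul_one, t0, t1,
    t2]
  ring

end QuadraticBasis

/-- The norm of an element of `ℤ[√79]` is never `-3`, by descent along the unit `80 + 9 √79`. -/
theorem sq_sub_79_mul_sq_ne_neg_three (y x : ℕ) : (x : ℤ) ^ 2 - 79 * (y : ℤ) ^ 2 ≠ -3 := by
  induction y using Nat.strong_induction_on generalizing x with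
  | _ y ih =>
    intro h
    rcases Nat.lt_or_ge y 2 with hy | hy
    · have hx : x < 10 := by
        by_contra! hx
        interval_cases y <;> push_cast at h <;> nlinarith
      interval_cases y <;> interval_cases x <;> omega
    · have hy' : (2 : ℤ) ≤ y := by exact_mod_cast hy
      have hx0 : (0 : ℤ) ≤ x := by positivity
      have hlt : |80 * (y : ℤ) - 9 * x| < y := by
        rw [abs_lt]
        constructor <;> nlinarith
      refine ih (80 * (y : ℤ) - 9 * x).natAbs (by zify; exact hlt) (80 * (x : ℤ) - 711 * y).natAbs ?_
      simp only [Int.natCast_natAbs, sq_abs]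
      linear_combination h

theorem natAbs_sq_sub_79_mul_sq_ne_three (x y : ℤ) : (x ^ 2 - 79 * y ^ 2).natAbs ≠ 3 := by
  intro h
  rcases Int.natAbs_eq_iff.mp h with h | h
  · have hsq (z : ℤ) : z ^ 2 % 4 = 0 ∨ z ^ 2 % 4 = 1 := by
      rcases Int.even_or_odd' z with ⟨k, rfl | rfl⟩ <;> ring_nf <;> omega
    have hx := hsq x
    have hy := hsq y
    push_cast at h
    omega
  · refine sq_sub_79_mul_sq_ne_neg_three y.natAbs x.natAbs ?_
    simpa using h

section Field

variable {K : Type*} [Field K] [NumberField K] {α : K}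

theorem exists_eq_add_mul_of_adjoin_eq_top (hα : α ^ 2 = 79) (hK : Algebra.adjoin ℚ {α} = ⊤)
    (z : K) : ∃ a b : ℚ, z = a + b * α := by
  have hz : z ∈ Algebra.adjoin ℚ {α} := hK ▸ Algebra.mem_top
  induction hz using Algebra.adjoin_induction with
  | mem x hx => exact ⟨0, 1, by simpa using hx⟩
  | algebraMap r => exact ⟨r, 0, by simp⟩
  | add x y _ _ hx hy =>
    obtain ⟨a, b, rfl⟩ := hx
    obtain ⟨c, d, rfl⟩ := hy
    exact ⟨a + c, b + d, by push_cast; ring⟩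
  | mul x y _ _ hx hy =>
    obtain ⟨a, b, rfl⟩ := hx
    obtain ⟨c, d, rfl⟩ := hy
    exact ⟨a * c + 79 * b * d, a * d + b * c, by push_cast; linear_combination b * d * hα⟩

theorem linearIndependent_one_sqrt79 (hα : α ^ 2 = 79) : LinearIndependent ℚ ![1, α] := by
  rw [LinearIndependent.pair_iff]
  intro s t h
  have ht : t = 0 := by
    by_contra ht
    have hst : (s / t) ^ 2 = (79 : ℚ) := by
      have h' : (s : K) + t * α = 0 := by simpa [Algebra.smul_def] using h
      have ht' : (t : K) ≠ 0 := by exact_mod_cast ht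
      have : ((s : K) / t) ^ 2 = 79 := by
        field_simp
        linear_combination (s - t * α) * h' + t ^ 2 * hα
      exact_mod_cast this
    have : IsSquare (79 : ℚ) := ⟨s / t, by rw [← sq, hst]⟩
    revert this
    rw [show (79 : ℚ) = ((79 : ℕ) : ℚ) by norm_num, Rat.isSquare_natCast_iff]
    exact (Nat.Prime.prime (by norm_num : Nat.Prime 79)).irreducible.not_isSquare
  exact ⟨by simpa [ht] using h, ht⟩

theorem exists_basis_one_sqrt79 (hα : α ^ 2 = 79) (hK : Algebra.adjoin ℚ {α} = ⊤) :
    ∃ b : Basis (Fin 2) ℚ K, b 0 = 1 ∧ b 1 = α := by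
  refine ⟨Basis.mk (linearIndependent_one_sqrt79 hα) fun z _ ↦ ?_, by simp, by simp⟩
  obtain ⟨a, b, rfl⟩ := exists_eq_add_mul_of_adjoin_eq_top hα hK z
  rw [Matrix.range_cons_cons_empty, Submodule.mem_span_pair]
  exact ⟨a, b, by simp [Algebra.smul_def]⟩

theorem exists_int_add_mul_of_isIntegral (hα : α ^ 2 = 79) (hK : Algebra.adjoin ℚ {α} = ⊤)
    {z : K} (hz : IsIntegral ℤ z) : ∃ x y : ℤ, z = x + y * α := by
  obtain ⟨B, h0, h1⟩ := exists_basis_one_sqrt79 hα hK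
  obtain ⟨a, b, rfl⟩ := exists_eq_add_mul_of_adjoin_eq_top hα hK z
  have hα' : α ^ 2 = algebraMap ℚ K 79 := by simpa using hα
  have ht := trace_of_sq_eq B h0 h1 hα' a b
  have hn := norm_of_sq_eq B h0 h1 hα' a b
  simp only [eq_ratCast] at ht hn
  obtain ⟨t, ht'⟩ := IsIntegrallyClosed.isIntegral_iff.mp (ht ▸ Algebra.isIntegral_trace hz)
  obtain ⟨n, hn'⟩ := IsIntegrallyClosed.isIntegral_iff.mp (hn ▸ Algebra.isIntegral_norm ℚ hz)
  simp only [eq_intCast] at ht' hn'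
  have hw : (158 * b) ^ 2 = ((79 * (t ^ 2 - 4 * n) : ℤ) : ℚ) := by
    push_cast
    rw [ht', hn']
    ring
  obtain ⟨w, hw'⟩ := IsIntegrallyClosed.isIntegral_iff.mp
    (IsIntegral.of_pow (R := ℤ) (x := 158 * b) two_pos (hw ▸ isIntegral_algebraMap))
  simp only [eq_intCast] at hw'
  rw [← hw'] at hw
  norm_cast at hw
  obtain ⟨s, rfl⟩ : (79 : ℤ) ∣ w :=
    Prime.dvd_of_dvd_pow (n := 2) (by norm_num) ⟨_, hw⟩
  have hs : 79 * s ^ 2 = t ^ 2 - 4 * n := by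
    have : (79 : ℤ) * (79 * s ^ 2) = 79 * (t ^ 2 - 4 * n) := by linear_combination hw
    exact mul_left_cancel₀ (by norm_num) this
  have hbs : 2 * b = s := by
    push_cast at hw'
    linear_combination -hw' / 79
  rcases Int.even_or_odd' t with ⟨k, rfl | rfl⟩ <;> rcases Int.even_or_odd' s with ⟨l, rfl | rfl⟩
  · refine ⟨k, l, ?_⟩
    have ha : a = k := by push_cast at ht'; linarith
    have hb : b = l := by push_cast at hbs; linarith
    simp [ha, hb]
  all_goals ring_nf at hs; omega

end Field

section ClassGroup

open Ideal
open scoped nonZeroDivisors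

variable {R : Type*} [CommRing R]

theorem span_three_sub_one_mul_span_three_add_one {θ : R} (hθ : θ ^ 2 = 79) :
    span {3, θ - 1} * span {3, θ + 1} = span {(3 : R)} := by
  rw [span_pair_mul_span_pair]
  refine le_antisymm ?_ ?_
  · simp only [span_le, Set.insert_subset_iff, Set.singleton_subset_iff, SetLike.mem_coe,
      mem_span_singleton]
    exact ⟨⟨3, rfl⟩, ⟨θ + 1, rfl⟩, ⟨θ - 1, by ring⟩, ⟨26, by linear_combination hθ⟩⟩
  · simp only [span_singleton_le_iff_mem, mem_span_insert, mem_span_singleton']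
    exact ⟨9, _, ⟨0, _, ⟨0, _, ⟨-1, rfl⟩, rfl⟩, rfl⟩, by linear_combination hθ⟩

theorem span_three_sub_one_mul_self {θ : R} (hθ : θ ^ 2 = 79) :
    span {3, θ - 1} * span {3, θ - 1} = span {(9 : R), θ - 4} := by
  rw [span_pair_mul_span_pair]
  refine le_antisymm ?_ ?_
  · simp only [span_le, Set.insert_subset_iff, Set.singleton_subset_iff, SetLike.mem_coe,
      mem_span_pair]
    exact ⟨⟨1, 0, by ring⟩, ⟨1, 3, by ring⟩, ⟨1, 3, by ring⟩,
      ⟨8, -2, by linear_combination -hθ⟩⟩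
  · simp only [span_le, Set.insert_subset_iff, Set.singleton_subset_iff, SetLike.mem_coe,
      mem_span_insert, mem_span_singleton']
    exact ⟨⟨1, _, ⟨0, _, ⟨0, _, ⟨0, rfl⟩, rfl⟩, rfl⟩, by ring⟩,
      ⟨-9, _, ⟨1, _, ⟨0, _, ⟨1, rfl⟩, rfl⟩, rfl⟩, by linear_combination -hθ⟩⟩

theorem span_three_sub_one_pow_three {θ : R} (hθ : θ ^ 2 = 79) :
    span {(3 : R), θ - 1} ^ 3 = span {17 - 2 * θ} := by
  rw [pow_succ', sq, span_three_sub_one_mul_self hθ, span_pair_mul_span_pair]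
  refine le_antisymm ?_ ?_
  · simp only [span_le, Set.insert_subset_iff, Set.singleton_subset_iff, SetLike.mem_coe,
      mem_span_singleton]
    exact ⟨⟨-(17 + 2 * θ), by linear_combination -4 * hθ⟩,
      ⟨-(θ + 10), by linear_combination -2 * hθ⟩,
      ⟨-(5 * θ + 47), by linear_combination -10 * hθ⟩,
      ⟨-(23 + 3 * θ), by linear_combination -5 * hθ⟩⟩
  · simp only [span_singleton_le_iff_mem, mem_span_insert, mem_span_singleton']
    exact ⟨-2, _, ⟨1, _, ⟨0, _, ⟨1, rfl⟩, rfl⟩, rfl⟩, by linear_combination -hθ⟩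

variable [IsDedekindDomain R]

theorem mk0_mem_of_mul_eq_span_singleton (H : Subgroup (ClassGroup R)) {I J : (Ideal R)⁰} {x : R}
    (h : (I : Ideal R) * J = span {x}) (hJ : ClassGroup.mk0 J ∈ H) : ClassGroup.mk0 I ∈ H := by
  have h1 : ClassGroup.mk0 (I * J) = 1 := by
    refine (ClassGroup.mk0_eq_one_iff (I * J).2).mpr ?_
    rw [Submonoid.coe_mul, h]
    exact ⟨⟨x, rfl⟩⟩
  rw [map_mul] at h1
  rw [eq_inv_of_mul_eq_one_left h1]
  exact H.inv_mem hJ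

variable [Module.Free ℤ R]

theorem eq_of_le_of_absNorm_eq {I J : Ideal R} (hle : I ≤ J)
    (h : absNorm I = absNorm J) (hJ : absNorm J ≠ 0) : I = J := by
  obtain ⟨L, rfl⟩ := dvd_iff_le.mpr hle
  rw [map_mul, Nat.mul_eq_left hJ, absNorm_eq_one_iff] at h
  rw [h, mul_top]

variable [Module.Finite ℤ R] {θ : R}

/-- Here `hN` says that the norm on `R = ℤ[√79]` is the usual one. -/
theorem absNorm_span_three_sub_one (hθ : θ ^ 2 = 79)
    (hN : ∀ x y : ℤ, Algebra.norm ℤ (x + y * θ) = x ^ 2 - 79 * y ^ 2) :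
    absNorm (span {(3 : R), θ - 1}) = 3 := by
  have h := congrArg absNorm (span_three_sub_one_pow_three hθ)
  have h27 := hN 17 (-2)
  push_cast at h27
  rw [map_pow, absNorm_span_singleton, show 17 - 2 * θ = 17 + -2 * θ by ring, h27] at h
  exact Nat.pow_left_injective (n := 3) (by norm_num) (h.trans (by norm_num))

theorem absNorm_span_three_add_one (hθ : θ ^ 2 = 79)
    (hN : ∀ x y : ℤ, Algebra.norm ℤ (x + y * θ) = x ^ 2 - 79 * y ^ 2) :
    absNorm (span {(3 : R), θ + 1}) = 3 := by
  have h := congrArg absNorm (span_three_sub_one_mul_span_three_add_one hθ)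
  have h9 := hN 3 0
  simp only [Int.cast_ofNat, Int.cast_zero, zero_mul, add_zero] at h9
  rw [map_mul, absNorm_span_three_sub_one hθ hN, absNorm_span_singleton, h9] at h
  norm_num at h
  omega

theorem mk0_mem_of_absNorm_eq_three (hθ : θ ^ 2 = 79)
    (hN : ∀ x y : ℤ, Algebra.norm ℤ (x + y * θ) = x ^ 2 - 79 * y ^ 2)
    (H : Subgroup (ClassGroup R)) {Q : (Ideal R)⁰} (hQ : (Q : Ideal R) = span {3, θ - 1})
    (hQH : ClassGroup.mk0 Q ∈ H) {I : (Ideal R)⁰} (hI : absNorm (I : Ideal R) = 3) :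
    ClassGroup.mk0 I ∈ H := by
  have hprime : (I : Ideal R).IsPrime :=
    isPrime_of_irreducible_absNorm (hI ▸ Nat.prime_three)
  have h3 : (3 : R) ∈ (I : Ideal R) := by
    have := absNorm_mem (I : Ideal R)
    rwa [hI] at this
  have h78 : (θ - 1) * (θ + 1) ∈ (I : Ideal R) := by
    rw [show (θ - 1) * (θ + 1) = 26 * 3 by linear_combination hθ]
    exact mul_mem_left _ _ h3
  have hle {a : R} (ha : a ∈ (I : Ideal R)) : span {3, a} ≤ (I : Ideal R) :=
    span_le.mpr (Set.insert_subset h3 (Set.singleton_subset_iff.mpr ha))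
  rcases hprime.mem_or_mem h78 with h | h
  · have hQI : Q = I := Subtype.ext <| hQ.trans <| eq_of_le_of_absNorm_eq (hle h)
      ((absNorm_span_three_sub_one hθ hN).trans hI.symm) (by simp [hI])
    rwa [← hQI]
  · refine mk0_mem_of_mul_eq_span_singleton H (x := 3) ?_ hQH
    rw [← eq_of_le_of_absNorm_eq (hle h) ((absNorm_span_three_add_one hθ hN).trans hI.symm)
      (by simp [hI]), hQ, mul_comm, span_three_sub_one_mul_span_three_add_one hθ]

theorem exists_mul_eq_span_of_mem {P : (Ideal R)⁰} {x : R} (hx : x ∈ (P : Ideal R))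
    {m n : ℕ} (hm : m ≠ 0) (hP : absNorm (P : Ideal R) = m)
    (hn : (Algebra.norm ℤ x).natAbs = m * n) (hn0 : n ≠ 0) :
    ∃ J : (Ideal R)⁰, (P : Ideal R) * J = span {x} ∧ absNorm (J : Ideal R) = n := by
  obtain ⟨J, hJ⟩ := dvd_iff_le.mpr ((span_singleton_le_iff_mem _).mpr hx)
  have h := congrArg absNorm hJ
  rw [absNorm_span_singleton, hn, map_mul, hP] at h
  have hJn : absNorm J = n := (Nat.eq_of_mul_eq_mul_left (Nat.pos_of_ne_zero hm) h).symm
  exact ⟨⟨J, absNorm_ne_zero_iff_mem_nonZeroDivisors.mp (hJn ▸ hn0)⟩, hJ.symm, hJn⟩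

/-- If `a ^ 2 - 79` is `p * n` up to sign, where `n` is coprime to `p`, then a prime containing `p`
is complementary to an ideal of norm `n` in a principal ideal. -/
theorem exists_mul_eq_span_of_prime_mem (hθ : θ ^ 2 = 79)
    (hN : ∀ x y : ℤ, Algebra.norm ℤ (x + y * θ) = x ^ 2 - 79 * y ^ 2)
    {P : (Ideal R)⁰} (hP : (P : Ideal R).IsPrime) {p n : ℕ} (hp : p.Prime)
    (hpP : (p : R) ∈ (P : Ideal R)) (a : ℤ) (ha : (a ^ 2 - 79).natAbs = p * n)
    (hpn : p.Coprime n) (hn0 : n ≠ 0) :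
    ∃ (J : (Ideal R)⁰) (x : R), (P : Ideal R) * J = span {x} ∧ absNorm (J : Ideal R) = n := by
  have hnorm (ε : ℤ) (hε : ε ^ 2 = 1) :
      (Algebra.norm ℤ ((a : R) + (ε : ℤ) * θ)).natAbs = p * n := by rw [hN, hε, mul_one, ha]
  have hmem : (a + (1 : ℤ) * θ) * (a + (-1 : ℤ) * θ) ∈ (P : Ideal R) := by
    have h : (p : ℤ) ∣ a ^ 2 - 79 := Int.natCast_dvd.mpr (ha ▸ dvd_mul_right p n)
    obtain ⟨k, hk⟩ := h
    have hk' : (a : R) ^ 2 - 79 = p * k := by exact_mod_cast congrArg (Int.cast (R := R)) hk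
    rw [show (a + (1 : ℤ) * θ) * (a + (-1 : ℤ) * θ) = k * p by
      push_cast
      linear_combination hk' - hθ]
    exact mul_mem_left _ _ hpP
  obtain ⟨ε, hε, hx⟩ : ∃ ε : ℤ, ε ^ 2 = 1 ∧ (a : R) + ε * θ ∈ (P : Ideal R) := by
    rcases hP.mem_or_mem hmem with h | h
    exacts [⟨1, by norm_num, h⟩, ⟨-1, by norm_num, h⟩]
  have hPp : absNorm (P : Ideal R) = p := by
    have h1 : absNorm (P : Ideal R) ∣ p * n := by
      rw [← hnorm ε hε]
      exact Int.natCast_dvd.mp (absNorm_dvd_norm_of_mem hx)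
    have h2 : absNorm (P : Ideal R) ∣ p ^ 2 := by
      have := absNorm_dvd_norm_of_mem hpP
      have hp2 : Algebra.norm ℤ (p : R) = p ^ 2 := by simpa using hN p 0
      rw [hp2] at this
      exact_mod_cast this
    have h3 : absNorm (P : Ideal R) ∣ p := by
      have := Nat.dvd_gcd h2 h1
      rwa [sq, Nat.gcd_mul_left, hpn.gcd_eq_one, mul_one] at this
    exact (hp.eq_one_or_self_of_dvd _ h3).resolve_left fun h ↦ hP.ne_top (absNorm_eq_one_iff.mp h)
  obtain ⟨J, hJ, hJn⟩ := exists_mul_eq_span_of_mem hx hp.ne_zero hPp (hnorm ε hε) hn0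
  exact ⟨J, _, hJ, hJn⟩

theorem mk0_mem_of_isPrime_of_absNorm_le (hθ : θ ^ 2 = 79)
    (hN : ∀ x y : ℤ, Algebra.norm ℤ (x + y * θ) = x ^ 2 - 79 * y ^ 2)
    (H : Subgroup (ClassGroup R)) {Q : (Ideal R)⁰} (hQ : (Q : Ideal R) = span {3, θ - 1})
    (hQH : ClassGroup.mk0 Q ∈ H) {P : (Ideal R)⁰} (hP : (P : Ideal R).IsPrime)
    (hP8 : absNorm (P : Ideal R) ≤ 8) : ClassGroup.mk0 P ∈ H := by
  have hmax : (P : Ideal R).IsMaximal := hP.isMaximal (nonZeroDivisors.coe_ne_zero P)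
  obtain ⟨p, k, hk, hpP, hp, hpk⟩ := exists_prime_and_absNorm_eq_pow (P : Ideal R)
  have hp8 : p ≤ 8 := (Nat.le_pow hk).trans (hpk ▸ hP8)
  have of_three {n : ℕ} (hn : n = 3) (a : ℤ) (ha : (a ^ 2 - 79).natAbs = p * n)
      (hpn : p.Coprime n) : ClassGroup.mk0 P ∈ H := by
    obtain ⟨J, x, hJ, hJn⟩ := exists_mul_eq_span_of_prime_mem hθ hN hP hp hpP a ha hpn (by omega)
    exact mk0_mem_of_mul_eq_span_singleton H hJ
      (mk0_mem_of_absNorm_eq_three hθ hN H hQ hQH (hJn.trans hn))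
  have hp' : p = 2 ∨ p = 3 ∨ p = 5 ∨ p = 7 := by
    interval_cases p <;> first | omega | (norm_num at hp)
  rcases hp' with rfl | rfl | rfl | rfl
  · obtain ⟨J, x, hJ, hJn⟩ := exists_mul_eq_span_of_prime_mem hθ hN hP hp hpP 9 (n := 1)
      (by norm_num) (by norm_num) one_ne_zero
    have hJ1 : J = 1 := Subtype.ext ((absNorm_eq_one_iff.mp hJn).trans one_eq_top.symm)
    exact mk0_mem_of_mul_eq_span_singleton H hJ (by simp [hJ1, H.one_mem])
  · refine mk0_mem_of_absNorm_eq_three hθ hN H hQ hQH ?_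
    have hk2 : k < 2 := by
      by_contra! hk2
      have := Nat.pow_le_pow_right (n := 3) (by norm_num) hk2
      omega
    rw [hpk, show k = 1 by omega, pow_one]
  · exact of_three rfl 8 (by norm_num) (by norm_num)
  · exact of_three rfl 10 (by norm_num) (by norm_num)

theorem mk0_mem_of_absNorm_le (hθ : θ ^ 2 = 79)
    (hN : ∀ x y : ℤ, Algebra.norm ℤ (x + y * θ) = x ^ 2 - 79 * y ^ 2)
    (H : Subgroup (ClassGroup R)) {Q : (Ideal R)⁰} (hQ : (Q : Ideal R) = span {3, θ - 1})
    (hQH : ClassGroup.mk0 Q ∈ H) (I : (Ideal R)⁰) (hI : absNorm (I : Ideal R) ≤ 8) :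
    ClassGroup.mk0 I ∈ H := by
  obtain ⟨I, hI0⟩ := I
  induction I using UniqueFactorizationMonoid.induction_on_prime with
  | h₁ => exact absurd rfl (nonZeroDivisors.ne_zero hI0)
  | h₂ I hIu =>
    have h1 : (⟨I, hI0⟩ : (Ideal R)⁰) = 1 := Subtype.ext ((isUnit_iff.mp hIu).trans one_eq_top.symm)
    simp [h1, H.one_mem]
  | h₃ J P hJ hP ih =>
    rw [map_mul] at hI
    have hJ0 := mem_nonZeroDivisors_of_ne_zero hJ
    have hP0 := mem_nonZeroDivisors_of_ne_zero hP.ne_zero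
    have hJpos := absNorm_pos_of_nonZeroDivisors ⟨J, hJ0⟩
    have hPpos := absNorm_pos_of_nonZeroDivisors ⟨P, hP0⟩
    have hmul : (⟨P * J, hI0⟩ : (Ideal R)⁰) = ⟨P, hP0⟩ * ⟨J, hJ0⟩ := rfl
    rw [hmul, map_mul]
    exact H.mul_mem
      (mk0_mem_of_isPrime_of_absNorm_le hθ hN H hQ hQH (isPrime_of_prime hP)
        ((Nat.le_mul_of_pos_right _ hJpos).trans hI))
      (ih hJ0 ((Nat.le_mul_of_pos_left _ hPpos).trans hI))

theorem not_isPrincipal_span_three_sub_one (hθ : θ ^ 2 = 79)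
    (hN : ∀ x y : ℤ, Algebra.norm ℤ (x + y * θ) = x ^ 2 - 79 * y ^ 2)
    (hR : ∀ z : R, ∃ x y : ℤ, z = x + y * θ) :
    ¬ (span {(3 : R), θ - 1}).IsPrincipal := by
  rintro ⟨z, hz⟩
  obtain ⟨x, y, rfl⟩ := hR z
  have h := absNorm_span_three_sub_one hθ hN
  rw [hz, submodule_span_eq, absNorm_span_singleton, hN] at h
  exact natAbs_sq_sub_79_mul_sq_ne_three x y h

end ClassGroup

section RingOfIntegers

variable {K : Type*} [Field K] [NumberField K] {θ : 𝓞 K}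

theorem exists_integral_basis_one_sqrt79 (hθ : θ ^ 2 = 79)
    (hR : ∀ z : 𝓞 K, ∃ x y : ℤ, z = x + y * θ) :
    ∃ b : Basis (Fin 2) ℤ (𝓞 K), b 0 = 1 ∧ b 1 = θ := by
  have hlin : LinearIndependent ℤ ![1, θ] := by
    have h := (linearIndependent_one_sqrt79 (α := (θ : K))
      (by rw [← map_pow, hθ, map_ofNat])).restrict_scalars' ℤ
    refine LinearIndependent.of_comp (Algebra.linearMap (𝓞 K) K |>.restrictScalars ℤ) ?_
    convert h using 1
    ext i
    fin_cases i <;> simp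
  refine ⟨Basis.mk hlin fun z _ ↦ ?_, by simp, by simp⟩
  obtain ⟨x, y, rfl⟩ := hR z
  rw [Matrix.range_cons_cons_empty, Submodule.mem_span_pair]
  exact ⟨x, y, by simp⟩

theorem minkowskiBound_lt_nine_of_discr_eq (hrank : finrank ℚ K = 2) (hdiscr : discr K = 316) :
    (4 / Real.pi) ^ InfinitePlace.nrComplexPlaces K *
      ((finrank ℚ K).factorial / (finrank ℚ K) ^ (finrank ℚ K) * √|discr K|) < 9 := by
  have hc : InfinitePlace.nrComplexPlaces K = 0 := by
    have h := InfinitePlace.card_add_two_mul_card_eq_rank K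
    have hs := sign_discr K
    rw [hrank] at h
    by_contra hc
    rw [show InfinitePlace.nrComplexPlaces K = 1 by omega, hdiscr] at hs
    exact absurd hs (by decide)
  have hsqrt : √(316 : ℝ) < 18 := by
    rw [Real.sqrt_lt' (by norm_num)]
    norm_num
  rw [hc, hrank, hdiscr]
  norm_num [Nat.factorial]
  linarith

end RingOfIntegers

open NumberField in
/-- The class number of the real quadratic field `ℚ(√79)` equals `3`. -/
theorem classNumber_sqrt79 (K : Type*) [Field K] [NumberField K]
    (α : K) (hα : α ^ 2 = 79) (hK : Algebra.adjoin ℚ {α} = ⊤) :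
    classNumber K = 3 := by
  obtain ⟨θ, rfl⟩ : ∃ θ : 𝓞 K, algebraMap (𝓞 K) K θ = α :=
    IsIntegralClosure.isIntegral_iff (R := ℤ).mp
      (.of_pow two_pos (by simpa [hα] using isIntegral_algebraMap (R := ℤ) (A := K) (x := 79)))
  have hθ : θ ^ 2 = 79 := RingOfIntegers.coe_injective (by rw [map_pow, hα, map_ofNat])
  have hR (z : 𝓞 K) : ∃ x y : ℤ, z = x + y * θ := by
    obtain ⟨x, y, h⟩ := exists_int_add_mul_of_isIntegral hα hK (RingOfIntegers.isIntegral_coe z)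
    exact ⟨x, y, RingOfIntegers.ext (by simpa using h)⟩
  obtain ⟨b, h0, h1⟩ := exists_integral_basis_one_sqrt79 hθ hR
  have hθ' : θ ^ 2 = algebraMap ℤ (𝓞 K) 79 := by simpa using hθ
  have hN (x y : ℤ) : Algebra.norm ℤ (x + y * θ) = x ^ 2 - 79 * y ^ 2 := by
    simpa using norm_of_sq_eq b h0 h1 hθ' x y
  have hdiscr : discr K = 316 := by
    rw [← discr_eq_discr K b, discr_of_sq_eq b h0 h1 hθ']
    norm_num
  have hrank : finrank ℚ K = 2 := by
    rw [← RingOfIntegers.rank K, finrank_eq_card_basis b, Fintype.card_fin]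
  have hQ0 : Ideal.span {3, θ - 1} ∈ nonZeroDivisors (Ideal (𝓞 K)) :=
    Ideal.absNorm_ne_zero_iff_mem_nonZeroDivisors.mp
      (by rw [absNorm_span_three_sub_one hθ hN]; norm_num)
  set c := ClassGroup.mk0 ⟨_, hQ0⟩ with hc
  have hc1 : c ≠ 1 := fun h ↦
    not_isPrincipal_span_three_sub_one hθ hN hR ((ClassGroup.mk0_eq_one_iff hQ0).mp h)
  have hc3 : c ^ 3 = 1 := by
    rw [hc, ← map_pow]
    refine (ClassGroup.mk0_eq_one_iff (pow_mem hQ0 3)).mpr ?_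
    rw [span_three_sub_one_pow_three hθ]
    exact ⟨⟨_, rfl⟩⟩
  have hgen (C : ClassGroup (𝓞 K)) : C ∈ Subgroup.zpowers c := by
    obtain ⟨I, rfl, hI⟩ := exists_ideal_in_class_of_norm_le C
    have hI9 := hI.trans_lt (minkowskiBound_lt_nine_of_discr_eq hrank hdiscr)
    refine mk0_mem_of_absNorm_le hθ hN _ rfl (Subgroup.mem_zpowers c) I (Nat.le_of_lt_succ ?_)
    exact_mod_cast hI9
  have : Fact (Nat.Prime 3) := ⟨Nat.prime_three⟩
  rw [classNumber, ← Nat.card_eq_fintype_card, ← orderOf_eq_card_of_forall_mem_zpowers hgen,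
    orderOf_eq_prime hc3 hc1]
end
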